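/- Let X be a Hilbert space and let (A, D(A)) generate a contraction C₀-semigroup on X. Let M, P : [0,∞) → L(X) be self-adjoint and uniformly coercive, with M strongly C²-continuous and M⁻¹ strongly continuous and P strongly C¹-differentiable, and let R : [0,∞) → L(X) be self-adjoint, uniformly coercive and strongly C¹-continuous with R(t)M(t) = M(t)R(t) for all t ≥ 0. Then {R(t)AM(t) + P(t) : t ≥ 0} generates a unique evolution family W with regularity spaces Y_t = M(t)⁻¹D(A), t ≥ 0. Moreover, for each F ∈ C¹([0,∞); X), s > 0 and x_s ∈ M(s)⁻¹D(A), the problem ẋ(t) = R(t)AM(t)x(t) + P(t)x(t) + F(t) on [s,∞), x(s) = x_s, has a unique classical solution, given by x(t) = W(t,s)x_s + ∫_s^t W(t,r)F(r) dr for t ≥ s. -/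

import Mathlib

open Set Filter MeasureTheory
open scoped ComplexInnerProductSpace

noncomputable section

namespace NBCS

/-! ### Evolution families and non-autonomous Cauchy problems -/

section NormedDefs

variable {X U Y : Type*}
variable [NormedAddCommGroup X] [NormedSpace ℂ X]
variable [NormedAddCommGroup U] [NormedSpace ℂ U]
variable [NormedAddCommGroup Y] [NormedSpace ℂ Y]

/-- An evolution family on `X`, indexed by `Δ = {(t,s) : 0 ≤ s ≤ t}`. -/
def IsEvolutionFamily (W : ℝ → ℝ → X →L[ℂ] X) : Prop :=
  (∀ t, 0 ≤ t → W t t = 1) ∧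
  (∀ s r t : ℝ, 0 ≤ s → s ≤ r → r ≤ t → W t s = (W t r).comp (W r s)) ∧
  (∀ x : X, ContinuousOn (fun p : ℝ × ℝ => W p.1 p.2 x) {p : ℝ × ℝ | 0 ≤ p.2 ∧ p.2 ≤ p.1})

/-- A backward evolution family on `X`. -/
def IsBackwardEvolutionFamily (V : ℝ → ℝ → X →L[ℂ] X) : Prop :=
  (∀ t, 0 ≤ t → V t t = 1) ∧
  (∀ s r t : ℝ, 0 ≤ s → s ≤ r → r ≤ t → V t s = (V r s).comp (V t r)) ∧
  (∀ x : X, ContinuousOn (fun p : ℝ × ℝ => V p.1 p.2 x) {p : ℝ × ℝ | 0 ≤ p.2 ∧ p.2 ≤ p.1})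

/-- A classical solution (continuous on `[s,∞)`, `C¹` on `(s,∞)`) of the inhomogeneous
non-autonomous Cauchy problem `ẋ(t) = A(t)x(t) + F(t)` on `[s,∞)`, `x(s) = xs`, where the
(in general unbounded) operator `A(t)` is encoded by a globally defined linear map together
with its domain `domA t`. -/
def IsClassicalSolution (A : ℝ → X →ₗ[ℂ] X) (domA : ℝ → Submodule ℂ X)
    (F : ℝ → X) (s : ℝ) (xs : X) (x : ℝ → X) : Prop :=
  ContinuousOn x (Ici s) ∧ x s = xs ∧ (∀ t, s ≤ t → x t ∈ domA t) ∧
  (∀ t, s < t → HasDerivAt x (A t (x t) + F t) t) ∧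
  ContinuousOn (fun t => A t (x t) + F t) (Ioi s)

/-- A classical solution which is `C¹` up to the initial time `s`. -/
def IsClassicalSolutionC1 (A : ℝ → X →ₗ[ℂ] X) (domA : ℝ → Submodule ℂ X)
    (F : ℝ → X) (s : ℝ) (xs : X) (x : ℝ → X) : Prop :=
  x s = xs ∧ (∀ t, s ≤ t → x t ∈ domA t) ∧
  (∀ t, s ≤ t → HasDerivWithinAt x (A t (x t) + F t) (Ici s) t) ∧
  ContinuousOn (fun t => A t (x t) + F t) (Ici s)

/-- The family `{A(t)}` generates the evolution family `W` with regularity spaces `Yreg`. -/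
def Generates (A : ℝ → X →ₗ[ℂ] X) (domA : ℝ → Submodule ℂ X)
    (W : ℝ → ℝ → X →L[ℂ] X) (Yreg : ℝ → Submodule ℂ X) : Prop :=
  IsEvolutionFamily W ∧
  (∀ t, 0 ≤ t → Dense (Yreg t : Set X)) ∧
  (∀ t, 0 ≤ t → Yreg t ≤ domA t) ∧
  (∀ s t : ℝ, 0 ≤ s → s ≤ t → ∀ x ∈ Yreg s, W t s x ∈ Yreg t) ∧
  (∀ s, 0 ≤ s → ∀ xs ∈ Yreg s,
    IsClassicalSolution A domA (fun _ => 0) s xs (fun t => W t s xs)) ∧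
  (∀ s, 0 ≤ s → ∀ xs ∈ Yreg s, ∀ x, IsClassicalSolution A domA (fun _ => 0) s xs x →
    ∀ t, s ≤ t → x t = W t s xs)

/-- A classical solution of the backward problem `u'(s) = -A(s)u(s)` on `[0,t]`, `u(t) = xt`. -/
def IsBackwardSolution (A : ℝ → X →ₗ[ℂ] X) (domA : ℝ → Submodule ℂ X)
    (t : ℝ) (xt : X) (u : ℝ → X) : Prop :=
  u t = xt ∧ (∀ s ∈ Icc (0:ℝ) t, u s ∈ domA s) ∧
  (∀ s ∈ Icc (0:ℝ) t, HasDerivWithinAt u (-(A s (u s))) (Icc (0:ℝ) t) s) ∧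
  ContinuousOn (fun s => A s (u s)) (Icc (0:ℝ) t)

/-- The family `{A(t)}` generates the backward evolution family `V` with
regularity spaces `Yreg`. -/
def GeneratesBackward (A : ℝ → X →ₗ[ℂ] X) (domA : ℝ → Submodule ℂ X)
    (V : ℝ → ℝ → X →L[ℂ] X) (Yreg : ℝ → Submodule ℂ X) : Prop :=
  IsBackwardEvolutionFamily V ∧
  (∀ t, 0 ≤ t → Dense (Yreg t : Set X)) ∧
  (∀ t, 0 ≤ t → Yreg t ≤ domA t) ∧
  (∀ s t : ℝ, 0 ≤ s → s ≤ t → ∀ x ∈ Yreg t, V t s x ∈ Yreg s) ∧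
  (∀ t, 0 ≤ t → ∀ xt ∈ Yreg t, IsBackwardSolution A domA t xt (fun s => V t s xt)) ∧
  (∀ t, 0 ≤ t → ∀ xt ∈ Yreg t, ∀ u, IsBackwardSolution A domA t xt u →
    ∀ s ∈ Icc (0:ℝ) t, u s = V t s xt)

/-! ### `C₀`-semigroups and Kato's classes -/

/-- `T` is a strongly continuous one-parameter semigroup on `X`. -/
def IsC0Semigroup (T : ℝ → X →L[ℂ] X) : Prop :=
  T 0 = 1 ∧ (∀ s t : ℝ, 0 ≤ s → 0 ≤ t → T (s + t) = (T s).comp (T t)) ∧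
  ∀ x : X, ContinuousOn (fun t => T t x) (Ici (0:ℝ))

/-- `A` (with domain `domA`) is the generator of the `C₀`-semigroup `T`. -/
def IsGenerator (A : X →ₗ[ℂ] X) (domA : Submodule ℂ X) (T : ℝ → X →L[ℂ] X) : Prop :=
  IsC0Semigroup T ∧
  (∀ x : X, x ∈ domA ↔
    ∃ y, Tendsto (fun h : ℝ => h⁻¹ • (T h x - x)) (nhdsWithin 0 (Ioi 0)) (nhds y)) ∧
  (∀ x ∈ domA, Tendsto (fun h : ℝ => h⁻¹ • (T h x - x)) (nhdsWithin 0 (Ioi 0)) (nhds (A x)))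

/-- `A` generates a contraction `C₀`-semigroup on `X` (with respect to the given norm). -/
def GeneratesContractionSemigroup (A : X →ₗ[ℂ] X) (domA : Submodule ℂ X) : Prop :=
  ∃ T : ℝ → X →L[ℂ] X, IsGenerator A domA T ∧ ∀ t, 0 ≤ t → ‖T t‖ ≤ 1

/-- `A` generates a `C₀`-semigroup on `X` which is contractive with respect to the
(equivalent) norm `N`. -/
def GeneratesContractionSemigroupWrt (N : X → ℝ) (A : X →ₗ[ℂ] X) (domA : Submodule ℂ X) :
    Prop :=
  ∃ T : ℝ → X →L[ℂ] X, IsGenerator A domA T ∧ ∀ t, 0 ≤ t → ∀ x : X, N (T t x) ≤ N x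

/-- `N` is a norm on `X` which is equivalent to the original norm. -/
def IsEquivNorm (N : X → ℝ) : Prop :=
  (∀ x y : X, N (x + y) ≤ N x + N y) ∧ (∀ (c : ℂ) (x : X), N (c • x) = ‖c‖ * N x) ∧
  (∀ x : X, N x = 0 ↔ x = 0) ∧
  ∃ m M : ℝ, 0 < m ∧ 0 < M ∧ ∀ x : X, m * ‖x‖ ≤ N x ∧ N x ≤ M * ‖x‖

/-- The family `{A(t)}` is Kato-stable. -/
def KatoStable (A : ℝ → X →ₗ[ℂ] X) (domA : ℝ → Submodule ℂ X) : Prop :=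
  ∃ N : ℝ → X → ℝ,
    (∀ t, 0 ≤ t → IsEquivNorm (N t)) ∧
    (∀ T : ℝ, 0 ≤ T → ∃ c : ℝ, 0 ≤ c ∧ ∀ (x : X), ∀ s ∈ Icc (0:ℝ) T, ∀ t ∈ Icc (0:ℝ) T,
      |N t x - N s x| ≤ c * |t - s| * N s x) ∧
    (∀ t, 0 ≤ t → GeneratesContractionSemigroupWrt (N t) (A t) (domA t))

/-- The family `{A(t)}` belongs to the elementary Kato class: every `A(t)` generates a
contraction `C₀`-semigroup on `X`. -/
def ElementaryKatoClass (A : ℝ → X →ₗ[ℂ] X) (domA : ℝ → Submodule ℂ X) : Prop :=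
  ∀ t, 0 ≤ t → GeneratesContractionSemigroup (A t) (domA t)

/-- The family `{A(t)}` belongs to Kato's class: it is Kato-stable, the operators have the
common domain `D` and `A(·)` is strongly `C¹`. -/
def KatoClass (A : ℝ → X →ₗ[ℂ] X) (domA : ℝ → Submodule ℂ X) (D : Submodule ℂ X) : Prop :=
  KatoStable A domA ∧ (∀ t, 0 ≤ t → domA t = D) ∧
  ∀ x ∈ D, ContDiffOn ℝ 1 (fun t => A t x) (Ici (0:ℝ))

/-! ### Boundary control and observation systems -/

/-- Compatibility of the operator `B̃ ∈ L(U,X)` with the boundary control system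
`(𝔄, D(𝔄), 𝔅)`:  `B̃u ∈ D(𝔄)`, `𝔄B̃ ∈ L(U,X)` and `𝔅B̃u = u` for all `u ∈ U`. -/
def BtCompat (Af : X →ₗ[ℂ] X) (domA : Submodule ℂ X) (Bf : X →ₗ[ℂ] U)
    (Bt : U →L[ℂ] X) : Prop :=
  (∀ v : U, Bt v ∈ domA) ∧ (∃ c : ℝ, ∀ v : U, ‖Af (Bt v)‖ ≤ c * ‖v‖) ∧
  ∀ v : U, Bf (Bt v) = v

/-- `Σ(𝔄,𝔅,𝔆)` is a boundary control and observation (BCO) system: the main operator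
`A = 𝔄|_{D(𝔄) ∩ ker 𝔅}` generates a `C₀`-semigroup, there is a compatible `B̃ ∈ L(U,X)`,
and `𝔆` is bounded with respect to the graph norm of `𝔄`. -/
def IsBCO (Af : X →ₗ[ℂ] X) (domA : Submodule ℂ X) (Bf : X →ₗ[ℂ] U) (Cf : X →ₗ[ℂ] Y) :
    Prop :=
  (∃ T : ℝ → X →L[ℂ] X, IsGenerator Af (domA ⊓ LinearMap.ker Bf) T) ∧
  (∃ Bt : U →L[ℂ] X, BtCompat Af domA Bf Bt) ∧
  (∃ c : ℝ, ∀ x ∈ domA, ‖Cf x‖ ≤ c * (‖x‖ + ‖Af x‖))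

/-- A classical solution of the autonomous boundary control problem
`ẋ(t) = 𝔄x(t)`, `𝔅x(t) = u(t)`, `x(0) = x₀`. -/
def IsClassicalSolAut (Af : X →ₗ[ℂ] X) (domA : Submodule ℂ X) (Bf : X →ₗ[ℂ] U)
    (u : ℝ → U) (x₀ : X) (x : ℝ → X) : Prop :=
  x 0 = x₀ ∧ (∀ t, (0:ℝ) ≤ t → x t ∈ domA) ∧
  (∀ t, (0:ℝ) ≤ t → HasDerivWithinAt x (Af (x t)) (Ici (0:ℝ)) t) ∧
  ContinuousOn (fun t => Af (x t)) (Ici (0:ℝ)) ∧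
  ∀ t, (0:ℝ) ≤ t → Bf (x t) = u t

/-- A classical solution pair `(x,y)` of the autonomous BCO system. -/
def IsClassicalSolPairAut (Af : X →ₗ[ℂ] X) (domA : Submodule ℂ X) (Bf : X →ₗ[ℂ] U)
    (Cf : X →ₗ[ℂ] Y) (u : ℝ → U) (x₀ : X) (x : ℝ → X) (y : ℝ → Y) : Prop :=
  IsClassicalSolAut Af domA Bf u x₀ x ∧ ContinuousOn y (Ici (0:ℝ)) ∧
  ∀ t, (0:ℝ) ≤ t → y t = Cf (x t)

/-- A classical solution of the non-autonomous boundary control problem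
`ẋ(t) = 𝔄(t)x(t)`, `𝔅(t)x(t) = u(t)`, `x(s) = xs` on `[s,∞)`. -/
def IsClassicalSolN (Af : ℝ → X →ₗ[ℂ] X) (domA : ℝ → Submodule ℂ X)
    (Bf : ℝ → X →ₗ[ℂ] U) (u : ℝ → U) (s : ℝ) (xs : X) (x : ℝ → X) : Prop :=
  x s = xs ∧ (∀ t, s ≤ t → x t ∈ domA t) ∧
  (∀ t, s ≤ t → HasDerivWithinAt x (Af t (x t)) (Ici s) t) ∧
  ContinuousOn (fun t => Af t (x t)) (Ici s) ∧
  ∀ t, s ≤ t → Bf t (x t) = u t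

/-- A classical solution pair `(x,y)` of the non-autonomous BCO system. -/
def IsClassicalSolPairN (Af : ℝ → X →ₗ[ℂ] X) (domA : ℝ → Submodule ℂ X)
    (Bf : ℝ → X →ₗ[ℂ] U) (Cf : ℝ → X →ₗ[ℂ] Y)
    (u : ℝ → U) (s : ℝ) (xs : X) (x : ℝ → X) (y : ℝ → Y) : Prop :=
  IsClassicalSolN Af domA Bf u s xs x ∧ ContinuousOn y (Ici s) ∧
  ∀ t, s ≤ t → y t = Cf t (x t)

/-- `Σ_N(𝔄,𝔅,𝔆)` is a non-autonomous boundary control and observation (NBCO) system: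
each frozen-time system is a BCO system and the family of main operators generates the
evolution family `W` with regularity spaces `Yreg`. -/
def IsNBCO (Af : ℝ → X →ₗ[ℂ] X) (domA : ℝ → Submodule ℂ X) (Bf : ℝ → X →ₗ[ℂ] U)
    (Cf : ℝ → X →ₗ[ℂ] Y) (W : ℝ → ℝ → X →L[ℂ] X) (Yreg : ℝ → Submodule ℂ X) : Prop :=
  (∀ t, 0 ≤ t → IsBCO (Af t) (domA t) (Bf t) (Cf t)) ∧
  Generates Af (fun t => domA t ⊓ LinearMap.ker (Bf t)) W Yreg

/-- Well-posedness of the non-autonomous BCO system. -/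
def WellPosedN (Af : ℝ → X →ₗ[ℂ] X) (domA : ℝ → Submodule ℂ X) (Bf : ℝ → X →ₗ[ℂ] U)
    (Cf : ℝ → X →ₗ[ℂ] Y) : Prop :=
  ∀ τ : ℝ, 0 < τ → ∃ m : ℝ, 0 < m ∧ ∀ s, 0 ≤ s → s ≤ τ →
    ∀ (u : ℝ → U) (xs : X) (x : ℝ → X) (y : ℝ → Y),
      IsClassicalSolPairN Af domA Bf Cf u s xs x y →
      ‖x τ‖ ^ 2 + ∫ r in s..τ, ‖y r‖ ^ 2 ≤ m * (‖xs‖ ^ 2 + ∫ r in s..τ, ‖u r‖ ^ 2)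

/-- `u ∈ L²_loc([0,∞); V)`. -/
def L2loc {V : Type*} [NormedAddCommGroup V] (u : ℝ → V) : Prop :=
  ∀ T : ℝ, 0 < T →
    AEStronglyMeasurable u (volume.restrict (Icc (0:ℝ) T)) ∧
    IntegrableOn (fun r => ‖u r‖ ^ 2) (Icc (0:ℝ) T)

end NormedDefs

/-! ### Hilbert space notions -/

section HilbertDefs

variable {X U Y V : Type*}
variable [NormedAddCommGroup X] [InnerProductSpace ℂ X]
variable [NormedAddCommGroup U] [InnerProductSpace ℂ U]
variable [NormedAddCommGroup Y] [InnerProductSpace ℂ Y]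
variable [NormedAddCommGroup V] [InnerProductSpace ℂ V]

/-- A family of bounded operators each of which is self-adjoint. -/
def SelfAdjointFamily (M : ℝ → V →L[ℂ] V) : Prop :=
  ∀ t, 0 ≤ t → ∀ x y : V, ⟪M t x, y⟫ = ⟪x, M t y⟫

/-- A uniformly coercive family of bounded operators. -/
def UniformlyCoercive (M : ℝ → V →L[ℂ] V) : Prop :=
  ∃ β : ℝ, 0 < β ∧ ∀ t, 0 ≤ t → ∀ x : V, β * ‖x‖ ^ 2 ≤ (⟪M t x, x⟫).re

/-- `B` (with domain `domB`) is the adjoint of the (densely defined) operator `A`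
(with domain `domA`). -/
def IsAdjointOp (A : X →ₗ[ℂ] X) (domA : Submodule ℂ X) (B : X →ₗ[ℂ] X)
    (domB : Submodule ℂ X) : Prop :=
  (∀ y ∈ domB, ∀ x ∈ domA, ⟪B y, x⟫ = ⟪y, A x⟫) ∧
  (∀ y z : X, (∀ x ∈ domA, ⟪z, x⟫ = ⟪y, A x⟫) → y ∈ domB ∧ z = B y)

/-- The autonomous BCO system `Σ(𝔄,𝔅,𝔆)` is `(P,R,J)`-scattering passive. -/
def ScatteringPassive (Af : X →ₗ[ℂ] X) (domA : Submodule ℂ X) (Bf : X →ₗ[ℂ] U)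
    (Cf : X →ₗ[ℂ] Y) (P : X →L[ℂ] X) (R : U →L[ℂ] U) (J : Y →L[ℂ] Y) : Prop :=
  ∀ (u : ℝ → U) (x₀ : X) (x : ℝ → X) (y : ℝ → Y),
    IsClassicalSolPairAut Af domA Bf Cf u x₀ x y →
    ∀ t, (0:ℝ) ≤ t → ∀ d : ℝ,
      HasDerivWithinAt (fun τ => (⟪P (x τ), x τ⟫).re) d (Ici (0:ℝ)) t →
      d ≤ (⟪R (u t), u t⟫).re - (⟪y t, J (y t)⟫).re

/-- The autonomous BCO system `Σ(𝔄,𝔅,𝔆)` is `(P,R,J)`-scattering energy preserving. -/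
def ScatteringEnergyPreserving (Af : X →ₗ[ℂ] X) (domA : Submodule ℂ X) (Bf : X →ₗ[ℂ] U)
    (Cf : X →ₗ[ℂ] Y) (P : X →L[ℂ] X) (R : U →L[ℂ] U) (J : Y →L[ℂ] Y) : Prop :=
  ∀ (u : ℝ → U) (x₀ : X) (x : ℝ → X) (y : ℝ → Y),
    IsClassicalSolPairAut Af domA Bf Cf u x₀ x y →
    ∀ t, (0:ℝ) ≤ t → ∀ d : ℝ,
      HasDerivWithinAt (fun τ => (⟪P (x τ), x τ⟫).re) d (Ici (0:ℝ)) t →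
      d = (⟪R (u t), u t⟫).re - (⟪y t, J (y t)⟫).re

/-- The non-autonomous BCO system `Σ_N(𝔄,𝔅,𝔆)` is `(R,P,J)`-scattering passive;
here `P'` is the strong derivative of `P`. -/
def NScatteringPassive (Af : ℝ → X →ₗ[ℂ] X) (domA : ℝ → Submodule ℂ X)
    (Bf : ℝ → X →ₗ[ℂ] U) (Cf : ℝ → X →ₗ[ℂ] Y)
    (R : ℝ → U →L[ℂ] U) (P P' : ℝ → X →L[ℂ] X) (J : ℝ → Y →L[ℂ] Y) : Prop :=
  ∀ s, (0:ℝ) ≤ s → ∀ (u : ℝ → U) (xs : X) (x : ℝ → X) (y : ℝ → Y),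
    IsClassicalSolPairN Af domA Bf Cf u s xs x y →
    ∀ t, s ≤ t → ∀ d : ℝ,
      HasDerivWithinAt (fun τ => (⟪P τ (x τ), x τ⟫).re) d (Ici s) t →
      d + (⟪y t, J t (y t)⟫).re ≤ (⟪u t, R t (u t)⟫).re + (⟪P' t (x t), x t⟫).re

/-- The pointwise characterization of `(R,P,J)`-scattering passivity of the non-autonomous
BCO system on the admissible spaces `𝒱(t)`. -/
def NScatteringPassivePointwise (Af : ℝ → X →ₗ[ℂ] X) (domA : ℝ → Submodule ℂ X)
    (Bf : ℝ → X →ₗ[ℂ] U) (Cf : ℝ → X →ₗ[ℂ] Y)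
    (R : ℝ → U →L[ℂ] U) (P : ℝ → X →L[ℂ] X) (J : ℝ → Y →L[ℂ] Y) : Prop :=
  ∀ t, (0:ℝ) ≤ t → ∀ (x : X) (u : U), x ∈ domA t → Bf t x = u →
    2 * (⟪Af t x, P t x⟫).re ≤ (⟪R t u, Bf t x⟫).re - (⟪Cf t x, J t (Cf t x)⟫).re

end HilbertDefs

end NBCS


namespace RAM
open Topology
variable {X : Type*} [NormedAddCommGroup X] [InnerProductSpace ℂ X]


/-- Strongly continuous, locally bounded operator family on `S`. -/
def SCont (S : Set ℝ) (K : ℝ → X →L[ℂ] X) : Prop :=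
  (∀ T : ℝ, ∃ c : ℝ, 0 ≤ c ∧ ∀ t ∈ S, t ≤ T → ‖K t‖ ≤ c) ∧
    ∀ x : X, ContinuousOn (fun t => K t x) S

/-- Strong derivative on `S`. -/
def SDer (S : Set ℝ) (K K' : ℝ → X →L[ℂ] X) : Prop :=
  ∀ x : X, ∀ t ∈ S, HasDerivWithinAt (fun τ => K τ x) (K' t x) S t

lemma SCont.mono {S S' : Set ℝ} {K : ℝ → X →L[ℂ] X} (h : SCont S K) (hs : S' ⊆ S) :
    SCont S' K := by
  refine ⟨fun T => ?_, fun x => (h.2 x).mono hs⟩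
  obtain ⟨c, hc, h1⟩ := h.1 T
  exact ⟨c, hc, fun t ht => h1 t (hs ht)⟩

lemma SDer.mono {S S' : Set ℝ} {K K' : ℝ → X →L[ℂ] X} (h : SDer S K K') (hs : S' ⊆ S) :
    SDer S' K K' :=
  fun x t ht => (h x t (hs ht)).mono hs

lemma SCont.tendsto {S : Set ℝ} {K : ℝ → X →L[ℂ] X} (h : SCont S K) {t : ℝ} (ht : t ∈ S)
    {l : Filter ℝ} (hl : l ≤ 𝓝[S] t) {u : ℝ → X} {y : X} (hu : Tendsto u l (𝓝 y)) :
    Tendsto (fun τ => K τ (u τ)) l (𝓝 (K t y)) := by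
  obtain ⟨c, hc, hb⟩ := h.1 (t + 1)
  have h1 : Tendsto (fun τ => K τ y) l (𝓝 (K t y)) := ((h.2 y) t ht).mono_left hl
  have hev : ∀ᶠ τ in l, ‖K τ (u τ) - K τ y‖ ≤ c * ‖u τ - y‖ := by
    apply hl
    have : ∀ᶠ τ in 𝓝[S] t, τ < t + 1 :=
      nhdsWithin_le_nhds (Iio_mem_nhds (by linarith))
    filter_upwards [this, self_mem_nhdsWithin] with τ h1 h2
    rw [← map_sub]
    exact (K τ).le_of_opNorm_le (hb τ h2 h1.le) _
  have h2 : Tendsto (fun τ => K τ (u τ) - K τ y) l (𝓝 0) := by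
    apply squeeze_zero_norm' hev
    have : Tendsto (fun τ => c * ‖u τ - y‖) l (𝓝 (c * ‖y - y‖)) :=
      ((hu.sub_const y).norm).const_mul c
    simpa using this
  simpa using h2.add h1

lemma SCont.apply {S : Set ℝ} {K : ℝ → X →L[ℂ] X} (h : SCont S K) {u : ℝ → X}
    (hu : ContinuousOn u S) : ContinuousOn (fun t => K t (u t)) S :=
  fun t ht => h.tendsto ht le_rfl (hu t ht)

lemma SDer.apply {S : Set ℝ} {K K' : ℝ → X →L[ℂ] X} (hd : SDer S K K') (h : SCont S K)
    {u : ℝ → X} {u' : X} {t : ℝ} (ht : t ∈ S) (hu : HasDerivWithinAt u u' S t) :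
    HasDerivWithinAt (fun τ => K τ (u τ)) (K' t (u t) + K t u') S t := by
  have h1 := hd (u t) t ht
  rw [hasDerivWithinAt_iff_tendsto_slope] at h1 hu ⊢
  have h2 := h.tendsto ht (nhdsWithin_mono t (sdiff_subset (s := S) (t := {t}))) hu
  refine (h1.add h2).congr' ?_
  filter_upwards with τ
  simp only [slope, vsub_eq_sub]
  rw [ContinuousLinearMap.map_smul_of_tower, ← smul_add, map_sub]
  congr 1
  abel

lemma SCont.comp {S : Set ℝ} {K L : ℝ → X →L[ℂ] X} (hK : SCont S K) (hL : SCont S L) :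
    SCont S (fun t => (K t).comp (L t)) := by
  refine ⟨fun T => ?_, fun x => hK.apply (hL.2 x)⟩
  obtain ⟨c, hc, h1⟩ := hK.1 T
  obtain ⟨d, hd, h2⟩ := hL.1 T
  refine ⟨c * d, by positivity, fun t ht hT => ?_⟩
  exact ((K t).opNorm_comp_le (L t)).trans (mul_le_mul (h1 t ht hT) (h2 t ht hT) (norm_nonneg _) hc)

lemma SCont.add {S : Set ℝ} {K L : ℝ → X →L[ℂ] X} (hK : SCont S K) (hL : SCont S L) :
    SCont S (fun t => K t + L t) := by
  refine ⟨fun T => ?_, fun x => (hK.2 x).add (hL.2 x)⟩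
  obtain ⟨c, hc, h1⟩ := hK.1 T
  obtain ⟨d, hd, h2⟩ := hL.1 T
  exact ⟨c + d, by positivity, fun t ht hT => (norm_add_le _ _).trans
    (add_le_add (h1 t ht hT) (h2 t ht hT))⟩

lemma SCont.neg {S : Set ℝ} {K : ℝ → X →L[ℂ] X} (hK : SCont S K) :
    SCont S (fun t => - K t) := by
  refine ⟨fun T => ?_, fun x => (hK.2 x).neg⟩
  obtain ⟨c, hc, h1⟩ := hK.1 T
  exact ⟨c, hc, fun t ht hT => by rw [norm_neg]; exact h1 t ht hT⟩

lemma SCont.const {S : Set ℝ} (K : X →L[ℂ] X) : SCont S (fun _ => K) :=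
  ⟨fun _ => ⟨‖K‖, norm_nonneg _, fun _ _ _ => le_rfl⟩, fun _ => continuousOn_const⟩

lemma SDer.comp {S : Set ℝ} {K K' L L' : ℝ → X →L[ℂ] X} (hd : SDer S K K') (h : SCont S K)
    (hL : SDer S L L') :
    SDer S (fun t => (K t).comp (L t)) (fun t => (K' t).comp (L t) + (K t).comp (L' t)) :=
  fun x t ht => hd.apply h ht (hL x t ht)

lemma SDer.add {S : Set ℝ} {K K' L L' : ℝ → X →L[ℂ] X} (hd : SDer S K K')
    (hL : SDer S L L') : SDer S (fun t => K t + L t) (fun t => K' t + L' t) :=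
  fun x t ht => (hd x t ht).add (hL x t ht)

lemma SDer.continuousOn {S : Set ℝ} {K K' : ℝ → X →L[ℂ] X} (hd : SDer S K K') (x : X) :
    ContinuousOn (fun t => K t x) S :=
  fun t ht => (hd x t ht).continuousWithinAt

lemma SCont.of_strong [CompleteSpace X] {K : ℝ → X →L[ℂ] X}
    (h : ∀ x, ContinuousOn (fun t => K t x) (Ici 0)) : SCont (Ici 0) K := by
  refine ⟨fun T => ?_, h⟩
  have := banach_steinhaus (g := fun t : Icc (0:ℝ) T => K t) (by
    intro x
    obtain ⟨c, hc⟩ := isCompact_Icc.exists_bound_of_continuousOn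
      ((h x).mono (Icc_subset_Ici_self (a := T) (b := 0)))
    exact ⟨c, fun i => hc i i.2⟩)
  obtain ⟨c, hc⟩ := this
  exact ⟨max c 0, le_max_right _ _, fun t ht hT => (hc ⟨t, ht, hT⟩).trans (le_max_left _ _)⟩

/-- Derivative of an inverse family. -/
lemma SDer.inv {S : Set ℝ} {K K' L : ℝ → X →L[ℂ] X} (hd : SDer S K K') (hL : SCont S L)
    (h1 : ∀ t ∈ S, (K t).comp (L t) = 1) (h2 : ∀ t ∈ S, (L t).comp (K t) = 1) :
    SDer S L (fun t => -((L t).comp ((K' t).comp (L t)))) := by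
  intro x t ht
  have h := hd (L t x) t ht
  rw [hasDerivWithinAt_iff_tendsto_slope] at h ⊢
  have h3 := (hL.tendsto ht (nhdsWithin_mono t (sdiff_subset (s := S) (t := {t}))) h).neg
  refine h3.congr' ?_
  filter_upwards [self_mem_nhdsWithin] with τ hτ
  simp only [slope, vsub_eq_sub]
  rw [ContinuousLinearMap.map_smul_of_tower, ← smul_neg, map_sub]
  congr 1
  have e1 : L τ (K τ (L t x)) = L t x := by
    simpa using congrArg (fun f => f (L t x)) (h2 τ hτ.1)
  have e2 : K t (L t x) = x := by simpa using congrArg (fun f => f x) (h1 t ht)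
  rw [e1, e2]; abel

/-- Existence of the strong derivative as an operator family. -/
lemma exists_SDer [CompleteSpace X] {K : ℝ → X →L[ℂ] X}
    (h : ∀ x, ContDiffOn ℝ 1 (fun t => K t x) (Ici 0)) :
    ∃ K' : ℝ → X →L[ℂ] X, SDer (Ici 0) K K' ∧ SCont (Ici 0) K' ∧
      ∀ x, ∀ t ∈ Ici (0:ℝ), K' t x = derivWithin (fun t => K t x) (Ici 0) t := by
  have hK : SCont (Ici 0) K := SCont.of_strong fun x => (h x).continuousOn
  have hu : UniqueDiffOn ℝ (Ici (0:ℝ)) := uniqueDiffOn_Ici 0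
  have hder : ∀ x, ∀ t ∈ Ici (0:ℝ), HasDerivWithinAt (fun t => K t x)
      (derivWithin (fun t => K t x) (Ici 0) t) (Ici 0) t := fun x t ht =>
    (((h x).differentiableOn (by norm_num)) t ht).hasDerivWithinAt
  have hcon : ∀ x, ContinuousOn (fun t => derivWithin (fun t => K t x) (Ici 0) t) (Ici 0) :=
    fun x => (h x).continuousOn_derivWithin hu le_rfl
  have key : ∀ t ∈ Ici (0:ℝ), ∃ K' : X →L[ℂ] X,
      ∀ x, K' x = derivWithin (fun t => K t x) (Ici 0) t := by
    intro t ht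
    have hne : (𝓝[Ici 0 \ {t}] t).NeBot := by
      have := (hu t ht)
      exact accPt_principal_iff_nhdsWithin.1 (this.accPt)
    refine ⟨continuousLinearMapOfTendsto (l := 𝓝[Ici 0 \ {t}] t)
      (f := fun x => derivWithin (fun t => K t x) (Ici 0) t)
      (fun τ => (τ - t)⁻¹ • (K τ - K t)) ?_, fun x => rfl⟩
    rw [tendsto_pi_nhds]
    intro x
    have := hder x t ht
    rw [hasDerivWithinAt_iff_tendsto_slope] at this
    exact this
  choose! K' hK' using key
  refine ⟨K', fun x t ht => ?_, ?_, fun x t ht => hK' t ht x⟩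
  · rw [hK' t ht x]; exact hder x t ht
  · refine SCont.of_strong fun x => (hcon x).congr fun t ht => hK' t ht x


/-- Maximal dissipative operator. -/
structure MaxDiss (A : X →ₗ[ℂ] X) (D : Submodule ℂ X) : Prop where
  dense : Dense (D : Set X)
  diss : ∀ x ∈ D, (⟪A x, x⟫).re ≤ 0
  res : ∀ ε : ℝ, 0 < ε → ∀ y : X, ∃ x ∈ D, x - ε • A x = y

lemma re_inner_real_smul_left (r : ℝ) (x y : X) : (⟪r • x, y⟫).re = r * (⟪x, y⟫).re := by
  rw [← Complex.coe_smul, inner_smul_left]; simp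

lemma re_inner_real_smul_right (r : ℝ) (x y : X) : (⟪x, r • y⟫).re = r * (⟪x, y⟫).re := by
  rw [← Complex.coe_smul, inner_smul_right]; simp

lemma re_inner_self (x : X) : (⟪x, x⟫).re = ‖x‖ ^ 2 := by
  have := inner_self_eq_norm_sq (𝕜 := ℂ) x
  simpa using this

lemma re_inner_le (x y : X) : (⟪x, y⟫).re ≤ ‖x‖ * ‖y‖ := by
  have := re_inner_le_norm (𝕜 := ℂ) x y
  simpa using this

lemma resolvent_mem [CompleteSpace X] {A : X →ₗ[ℂ] X} {D : Submodule ℂ X}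
    {T : ℝ → X →L[ℂ] X} (hT : NBCS.IsGenerator A D T) (hc : ∀ t, 0 ≤ t → ‖T t‖ ≤ 1)
    {l : ℝ} (hl : 0 < l) (y : X) : ∃ u ∈ D, l • u - A u = y := by
  obtain ⟨⟨h0, hadd, hcont⟩, hdom, hgen⟩ := hT
  set f : ℝ → X := fun t => Real.exp (-l * t) • T t y with hf
  have hfc : ContinuousOn f (Ici 0) :=
    (by fun_prop : Continuous fun t : ℝ => Real.exp (-l * t)).continuousOn.smul (hcont y)
  have hIntg : IntegrableOn f (Ioi 0) := by
    have h1 : IntegrableOn (fun t : ℝ => Real.exp (-l * t) * ‖y‖) (Ioi 0) :=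
      (integrableOn_exp_mul_Ioi (by linarith) 0).mul_const _
    refine Integrable.mono' h1 ((hfc.mono Ioi_subset_Ici_self).aestronglyMeasurable
      measurableSet_Ioi) ?_
    filter_upwards [ae_restrict_mem measurableSet_Ioi] with t ht
    rw [hf]; simp only [norm_smul, Real.norm_eq_abs, Real.abs_exp]
    gcongr
    simpa using (T t).le_of_opNorm_le (hc t (le_of_lt ht)) y
  set u := ∫ t in Ioi (0:ℝ), f t with hu
  have hTu : ∀ h : ℝ, 0 < h → T h u = Real.exp (l * h) • (u - ∫ t in (0:ℝ)..h, f t) := by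
    intro h hh
    have e1 : T h u = ∫ t in Ioi (0:ℝ), T h (f t) :=
      ((T h).integral_comp_comm hIntg).symm
    have e2 : ∫ t in Ioi (0:ℝ), T h (f t) = ∫ t in Ioi (0:ℝ), Real.exp (l * h) • f (t + h) := by
      refine setIntegral_congr_fun measurableSet_Ioi fun t ht => ?_
      simp only [hf]
      rw [ContinuousLinearMap.map_smul_of_tower, smul_smul, ← Real.exp_add,
        add_comm t h, hadd h t hh.le (le_of_lt ht)]
      congr 2; ring
    have e3 : ∫ t in Ioi (0:ℝ), f (t + h) = ∫ t in Ioi h, f t := by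
      have := (measurePreserving_add_right volume h).setIntegral_preimage_emb
        (measurableEmbedding_addRight h) f (Ioi h)
      simpa using this
    have e4 : u - ∫ t in (0:ℝ)..h, f t = ∫ t in Ioi h, f t := by
      rw [intervalIntegral.integral_of_le hh.le, hu, ← Ioc_union_Ioi_eq_Ioi hh.le,
        setIntegral_union (Ioc_disjoint_Ioi le_rfl) measurableSet_Ioi
          (hIntg.mono_set Ioc_subset_Ioi_self) (hIntg.mono_set (Ioi_subset_Ioi hh.le))]
      abel
    rw [e1, e2, integral_smul, e3, e4]
  have hlim : Tendsto (fun h : ℝ => h⁻¹ • (T h u - u)) (𝓝[>] 0) (𝓝 (l • u - y)) := by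
    have d1 : HasDerivWithinAt (fun h : ℝ => Real.exp (l * h)) l (Ici 0) 0 := by
      have : HasDerivAt (fun h : ℝ => Real.exp (l * h)) (Real.exp (l * 0) * (l * 1)) 0 :=
        ((hasDerivAt_id (0:ℝ)).const_mul l).exp
      simpa using this.hasDerivWithinAt
    have d2 : HasDerivWithinAt (fun h : ℝ => ∫ t in (0:ℝ)..h, f t) (f 0) (Ici 0) 0 := by
      apply intervalIntegral.integral_hasDerivWithinAt_right
      · simp
      · exact ⟨Ioi 0, self_mem_nhdsWithin,
          (hfc.mono Ioi_subset_Ici_self).aestronglyMeasurable measurableSet_Ioi⟩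
      · exact (hfc 0 (by simp)).mono Ioi_subset_Ici_self
    have d3 := d1.fun_smul ((hasDerivWithinAt_const (0:ℝ) (Ici 0) u).fun_sub d2)
    rw [hasDerivWithinAt_iff_tendsto_slope] at d3
    have e : (Ici (0:ℝ)) \ {0} = Ioi 0 := by ext; simp [lt_iff_le_and_ne, eq_comm]
    rw [e] at d3
    have hv : Real.exp (l * 0) • (0 - f 0) + l • (u - ∫ t in (0:ℝ)..0, f t) = l • u - y := by
      simp [hf, h0]; abel
    rw [hv] at d3
    refine d3.congr' ?_
    filter_upwards [self_mem_nhdsWithin] with h hh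
    rw [hTu h hh]; simp [slope]
  have hmem : u ∈ D := (hdom u).2 ⟨_, hlim⟩
  refine ⟨u, hmem, ?_⟩
  have := tendsto_nhds_unique (hgen u hmem) hlim
  rw [this]; abel

lemma MaxDiss.of_generates [CompleteSpace X] {A : X →ₗ[ℂ] X} {D : Submodule ℂ X}
    (hA : NBCS.GeneratesContractionSemigroup A D) : MaxDiss A D := by
  obtain ⟨T, hT, hc⟩ := hA
  have hdiss : ∀ x ∈ D, (⟪A x, x⟫).re ≤ 0 := by
    intro x hx
    have h1 := hT.2.2 x hx
    have h2 : Tendsto (fun h : ℝ => (⟪h⁻¹ • (T h x - x), x⟫).re) (𝓝[>] 0) (𝓝 (⟪A x, x⟫).re) :=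
      (Complex.continuous_re.tendsto _).comp (h1.inner tendsto_const_nhds)
    refine le_of_tendsto h2 ?_
    filter_upwards [self_mem_nhdsWithin] with h hh
    rw [re_inner_real_smul_left]
    have hh' : (0:ℝ) < h := hh
    refine mul_nonpos_of_nonneg_of_nonpos (by positivity) ?_
    rw [inner_sub_left, Complex.sub_re, re_inner_self]
    have h3 : ‖T h x‖ ≤ ‖x‖ := by simpa using (T h).le_of_opNorm_le (hc h hh'.le) x
    have h4 := re_inner_le (T h x) x
    nlinarith [norm_nonneg x]
  refine ⟨?_, hdiss, ?_⟩
  · rw [Submodule.dense_iff_topologicalClosure_eq_top, Submodule.topologicalClosure_eq_top_iff,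
      Submodule.eq_bot_iff]
    intro y hy
    obtain ⟨u, hu, huy⟩ := resolvent_mem hT hc one_pos y
    have h1 : ⟪u, y⟫ = 0 := (Submodule.mem_orthogonal D y).1 hy u hu
    have h2 : (⟪y, u⟫).re = 0 := by
      rw [← inner_conj_symm, h1]; simp
    rw [← huy, inner_sub_left, Complex.sub_re, one_smul, re_inner_self] at h2
    have h3 := hdiss u hu
    have h4 : ‖u‖ ^ 2 = 0 := le_antisymm (by linarith) (by positivity)
    have h5 : u = 0 := by simpa using h4
    rw [← huy, h5]; simp
  · intro ε hε y
    obtain ⟨u, hu, huy⟩ := resolvent_mem hT hc (inv_pos.2 hε) (ε⁻¹ • y)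
    refine ⟨u, hu, ?_⟩
    have := congrArg (fun z => ε • z) huy
    simpa [smul_sub, smul_smul, hε.ne'] using this

/-- The Yosida data. -/
lemma MaxDiss.exists_J {A : X →ₗ[ℂ] X} {D : Submodule ℂ X} (h : MaxDiss A D) {ε : ℝ}
    (hε : 0 < ε) : ∃ J : X →L[ℂ] X, (∀ y, J y ∈ D) ∧ (∀ y, J y - ε • A (J y) = y) ∧
      (∀ x ∈ D, J (x - ε • A x) = x) ∧ ‖J‖ ≤ 1 := by
  have hn : ∀ x ∈ D, ‖x‖ ≤ ‖x - ε • A x‖ := by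
    intro x hx
    have h1 := re_inner_le (x - ε • A x) x
    rw [inner_sub_left, Complex.sub_re, re_inner_self, re_inner_real_smul_left] at h1
    have h2 := h.diss x hx
    by_contra hcon
    push Not at hcon
    have : 0 < ‖x‖ := (norm_nonneg _).trans_lt hcon
    nlinarith
  have hinj : ∀ x ∈ D, ∀ x' ∈ D, x - ε • A x = x' - ε • A x' → x = x' := by
    intro x hx x' hx' he
    have := hn (x - x') (D.sub_mem hx hx')
    rw [map_sub, smul_sub, show x - x' - (ε • A x - ε • A x') = (x - ε • A x) - (x' - ε • A x') by abel,
      he, sub_self, norm_zero] at this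
    exact sub_eq_zero.1 (norm_le_zero_iff.1 this)
  choose j hjD hj using h.res ε hε
  let Jl : X →ₗ[ℂ] X :=
    { toFun := j
      map_add' := by
        intro x y
        refine hinj _ (hjD _) _ (D.add_mem (hjD _) (hjD _)) ?_
        rw [hj, map_add, smul_add]
        nth_rw 1 [← hj x, ← hj y]; abel
      map_smul' := by
        intro c x
        refine hinj _ (hjD _) _ (D.smul_mem _ (hjD _)) ?_
        rw [hj, RingHom.id_apply, map_smul, smul_comm ε c, ← smul_sub, hj] }
  refine ⟨Jl.mkContinuous 1 ?_, hjD, hj, ?_, LinearMap.mkContinuous_norm_le _ zero_le_one _⟩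
  · intro y
    rw [one_mul]
    have := hn (j y) (hjD y)
    rw [hj] at this
    exact this
  · intro x hx
    exact hinj _ (hjD _) _ hx (hj _)

/-- Yosida approximation along `ε_n = 1/(n+1)`. -/
lemma MaxDiss.exists_yosida {A : X →ₗ[ℂ] X} {D : Submodule ℂ X} (h : MaxDiss A D) :
    ∃ (J Y : ℕ → X →L[ℂ] X), (∀ n y, J n y ∈ D) ∧ (∀ n y, A (J n y) = Y n y) ∧
      (∀ n y, y - J n y = -((1 / ((n:ℝ) + 1)) • Y n y)) ∧
      (∀ n y, (⟪Y n y, y⟫).re ≤ 0) ∧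
      (∀ x ∈ D, Tendsto (fun n => Y n x) atTop (𝓝 (A x))) := by
  have hpos : ∀ n : ℕ, (0:ℝ) < 1 / ((n:ℝ) + 1) := fun n => by positivity
  choose J hJD hJ hJ2 hJn using fun n : ℕ => h.exists_J (hpos n)
  set Y : ℕ → X →L[ℂ] X := fun n => ((n:ℝ) + 1) • (J n - 1) with hY
  have hAJ : ∀ n y, A (J n y) = Y n y := by
    intro n y
    have hn : ((n:ℝ) + 1) ≠ 0 := by positivity
    have h1 : (1 / ((n:ℝ) + 1)) • A (J n y) = J n y - y := by
      nth_rw 3 [← hJ n y]; abel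
    have h2 := congrArg (fun z => ((n:ℝ) + 1) • z) h1
    simp only [smul_smul, mul_one_div_cancel hn, one_smul] at h2
    rw [h2, hY]; simp
  have hYJ : ∀ n y, y - J n y = -((1 / ((n:ℝ) + 1)) • Y n y) := by
    intro n y
    rw [← hAJ]
    nth_rw 1 [← hJ n y]; abel
  have hJlim : ∀ y, Tendsto (fun n => J n y) atTop (𝓝 y) := by
    intro y
    rw [Metric.tendsto_atTop]
    intro e he
    obtain ⟨x, hx, hxy⟩ := Metric.mem_closure_iff.1 (h.dense y) (e / 4) (by positivity)
    obtain ⟨N, hN⟩ := exists_nat_gt (‖A x‖ / (e / 4))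
    refine ⟨N, fun n hn => ?_⟩
    have h1 : ‖J n x - x‖ ≤ (1 / ((n:ℝ) + 1)) * ‖A x‖ := by
      have : J n x - x = (1 / ((n:ℝ) + 1)) • J n (A x) := by
        have h3 := hJ2 n x hx
        rw [map_sub, ContinuousLinearMap.map_smul_of_tower] at h3
        nth_rw 2 [← h3]; abel
      rw [this, norm_smul, Real.norm_eq_abs, abs_of_pos (hpos n)]
      gcongr
      simpa using (J n).le_of_opNorm_le (hJn n) (A x)
    have h2 : (1 / ((n:ℝ) + 1)) * ‖A x‖ < e / 4 := by
      rw [div_lt_iff₀ (by positivity)] at hN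
      have : (N:ℝ) ≤ n := by exact_mod_cast hn
      rw [one_div, inv_mul_lt_iff₀ (by positivity)]
      nlinarith
    have h3 : ‖J n (y - x)‖ ≤ ‖y - x‖ := by
      simpa using (J n).le_of_opNorm_le (hJn n) (y - x)
    rw [dist_eq_norm] at hxy ⊢
    have : J n y - y = J n (y - x) + (J n x - x) - (y - x) := by rw [map_sub]; abel
    rw [this]
    calc _ ≤ ‖J n (y - x)‖ + ‖J n x - x‖ + ‖y - x‖ :=
          (norm_sub_le _ _).trans (by gcongr; exact norm_add_le _ _)
      _ < e := by linarith
  refine ⟨J, Y, hJD, hAJ, hYJ, ?_, ?_⟩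
  · intro n y
    have e1 : y = J n y - (1 / ((n:ℝ) + 1)) • Y n y := by
      have := hYJ n y; rw [sub_eq_iff_eq_add] at this
      nth_rw 1 [this]; abel
    have e2 : (⟪Y n y, y⟫).re = (⟪Y n y, J n y⟫).re - (1 / ((n:ℝ) + 1)) * ‖Y n y‖ ^ 2 := by
      nth_rw 2 [e1]
      rw [inner_sub_right, Complex.sub_re, re_inner_real_smul_right, re_inner_self]
    rw [e2, ← hAJ]
    have := h.diss _ (hJD n y)
    have := hpos n
    have : 0 ≤ (1 / ((n:ℝ) + 1)) * ‖A (J n y)‖ ^ 2 := by positivity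
    linarith
  · intro x hx
    have : ∀ n, Y n x = J n (A x) := by
      intro n
      have h3 := hJ2 n x hx
      rw [map_sub, ContinuousLinearMap.map_smul_of_tower] at h3
      have h4 := hYJ n x
      have hn : ((n:ℝ) + 1) ≠ 0 := by positivity
      have h5 : (1 / ((n:ℝ) + 1)) • Y n x = (1 / ((n:ℝ) + 1)) • J n (A x) := by
        have h6 := neg_eq_iff_eq_neg.1 h4.symm
        rw [h6, neg_sub, sub_eq_iff_eq_add]; nth_rw 1 [sub_eq_iff_eq_add.1 h3]; abel
      have h7 := congrArg (fun z => ((n:ℝ) + 1) • z) h5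
      simpa only [smul_smul, mul_one_div_cancel hn, one_smul] using h7
    simp_rw [this]
    exact hJlim _

lemma MaxDiss.closed {A : X →ₗ[ℂ] X} {D : Submodule ℂ X} (h : MaxDiss A D) {u : ℕ → X}
    {x y : X} (hu : ∀ n, u n ∈ D) (h1 : Tendsto u atTop (𝓝 x))
    (h2 : Tendsto (fun n => A (u n)) atTop (𝓝 y)) : x ∈ D ∧ A x = y := by
  obtain ⟨J, hJD, hJ, hJ2, -⟩ := h.exists_J one_pos
  have h3 : Tendsto (fun n => J (u n - (1:ℝ) • A (u n))) atTop (𝓝 (J (x - (1:ℝ) • y))) :=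
    (J.continuous.tendsto _).comp (h1.sub (h2.const_smul (1:ℝ)))
  have h4 : x = J (x - (1:ℝ) • y) := by
    refine tendsto_nhds_unique h1 (h3.congr fun n => hJ2 _ (hu n))
  have h5 := hJ (x - (1:ℝ) • y)
  rw [← h4] at h5
  refine ⟨h4 ▸ hJD _, ?_⟩
  simpa using h5


/-- Clamp to `[a,b]`. -/
def clamp (a b t : ℝ) : ℝ := max a (min b t)

lemma clamp_mem {a b : ℝ} (hab : a ≤ b) (t : ℝ) : clamp a b t ∈ Icc a b :=
  ⟨le_max_left _ _, max_le hab (min_le_left _ _)⟩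

lemma clamp_eq {a b t : ℝ} (ht : t ∈ Icc a b) : clamp a b t = t := by
  simp [clamp, ht.1, ht.2]

lemma continuous_clamp (a b : ℝ) : Continuous (clamp a b) := by
  unfold clamp; fun_prop

lemma continuous_comp_clamp {Z : Type*} [TopologicalSpace Z] {a b : ℝ} (hab : a ≤ b) {f : ℝ → Z}
    (hf : ContinuousOn f (Icc a b)) : Continuous (fun t => f (clamp a b t)) :=
  hf.comp_continuous (continuous_clamp a b) (clamp_mem hab)

/-- Energy estimate. -/
lemma energy {a b : ℝ} {G G' : ℝ → X →L[ℂ] X} (hG : SCont (Icc a b) G)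
    (hG' : SDer (Icc a b) G G') {β c l : ℝ} (hβ : 0 < β) (hc : 0 ≤ c)
    (hco : ∀ t ∈ Icc a b, ∀ x, β * ‖x‖ ^ 2 ≤ (⟪G t x, x⟫).re)
    (hGc : ∀ t ∈ Icc a b, ‖G' t‖ ≤ c)
    (hsa : ∀ t ∈ Icc a b, ∀ x y, ⟪G t x, y⟫ = ⟪x, G t y⟫)
    (hl : c + 1 ≤ l * β) {u u' : ℝ → X} (hu : ContinuousOn u (Icc a b))
    (hd : ∀ t ∈ Ioo a b, HasDerivAt u (u' t) t) {η ρ : ℝ} (hρ : 0 ≤ ρ)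
    (h : ∀ t ∈ Ioo a b, (⟪G t (u' t), u t⟫).re ≤ -l * (⟪G t (u t), u t⟫).re + η * ‖u t‖ + ρ) :
    ∀ t ∈ Icc a b,
      (⟪G t (u t), u t⟫).re ≤ (⟪G a (u a), u a⟫).re + (η ^ 2 + 2 * ρ) / l ∧
      (⟪G t (u t), u t⟫).re ≤ (⟪G a (u a), u a⟫).re + (η ^ 2 + 2 * ρ) * (t - a) := by
  have hl0 : 0 < l := by
    by_contra hcon
    push Not at hcon
    nlinarith
  set E : ℝ → ℝ := fun t => (⟪G t (u t), u t⟫).re with hE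
  set m := η ^ 2 + 2 * ρ with hm
  have hm0 : 0 ≤ m := by positivity
  have hE0 : ∀ t ∈ Icc a b, 0 ≤ E t := fun t ht => le_trans (by positivity) (hco t ht (u t))
  have hEc : ContinuousOn E (Icc a b) :=
    Complex.continuous_re.comp_continuousOn ((hG.apply hu).inner hu)
  have hEd : ∀ t ∈ Ioo a b, ∃ e, HasDerivAt E e t ∧ e ≤ -l * E t + m := by
    intro t ht
    have ht' := Ioo_subset_Icc_self ht
    have hnb : Icc a b ∈ 𝓝 t := Icc_mem_nhds ht.1 ht.2
    have h1 : HasDerivAt (fun τ => G τ (u τ)) (G' t (u t) + G t (u' t)) t :=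
      (hG'.apply hG ht' (hd t ht).hasDerivWithinAt).hasDerivAt hnb
    have h2 := h1.inner ℂ (hd t ht)
    have h3 := (Complex.reCLM.hasFDerivAt.comp_hasDerivAt t h2)
    refine ⟨_, h3, ?_⟩
    have e1 : (⟪G t (u t), u' t⟫).re = (⟪G t (u' t), u t⟫).re := by
      rw [hsa t ht', ← inner_conj_symm, Complex.conj_re]
    simp only [Complex.reCLM_apply, Complex.add_re, inner_add_left]
    rw [e1]
    have e2 := h t ht
    have e3 : (⟪G' t (u t), u t⟫).re ≤ c * ‖u t‖ ^ 2 := by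
      refine (re_inner_le _ _).trans ?_
      have := (G' t).le_of_opNorm_le (hGc t ht') (u t)
      nlinarith [norm_nonneg (u t)]
    have e4 := hco t ht' (u t)
    have e5 : (c + 1) * ‖u t‖ ^ 2 ≤ l * E t := by
      calc (c + 1) * ‖u t‖ ^ 2 ≤ (l * β) * ‖u t‖ ^ 2 := by gcongr
        _ = l * (β * ‖u t‖ ^ 2) := by ring
        _ ≤ _ := by gcongr
    have e6 : E t = (⟪G t (u t), u t⟫).re := rfl
    rw [← e6] at e2
    nlinarith [sq_nonneg (η - ‖u t‖)]
  choose! e he hle using hEd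
  intro t ht
  have ha : a ∈ Icc a b := ⟨le_rfl, ht.1.trans ht.2⟩
  constructor
  · have hanti : AntitoneOn (fun τ => Real.exp (l * τ) * (E τ - m / l)) (Icc a b) := by
      have hder : ∀ τ ∈ Ioo a b, HasDerivAt (fun τ => Real.exp (l * τ) * (E τ - m / l))
          (Real.exp (l * τ) * (l * 1) * (E τ - m / l) + Real.exp (l * τ) * (e τ)) τ := by
        intro τ hτ
        exact (((hasDerivAt_id τ).const_mul l).exp).mul ((he τ hτ).sub_const _)
      refine antitoneOn_of_deriv_nonpos (convex_Icc a b) ?_ ?_ ?_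
      · exact (by fun_prop : Continuous fun τ => Real.exp (l * τ)).continuousOn.mul
          (hEc.sub continuousOn_const)
      · rw [interior_Icc]
        exact fun τ hτ => (hder τ hτ).differentiableAt.differentiableWithinAt
      · rw [interior_Icc]
        intro τ hτ
        rw [(hder τ hτ).deriv]
        have := hle τ hτ
        have e1 : Real.exp (l * τ) * (l * 1) * (E τ - m / l) + Real.exp (l * τ) * (e τ)
          = Real.exp (l * τ) * (l * E τ - m + e τ) := by field_simp
        rw [e1]
        exact mul_nonpos_of_nonneg_of_nonpos (Real.exp_pos _).le (by linarith)
    have h1 := hanti ha ht ht.1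
    simp only at h1
    have h2 : Real.exp (l * a) ≤ Real.exp (l * t) := by
      rw [Real.exp_le_exp]; exact mul_le_mul_of_nonneg_left ht.1 hl0.le
    have h3 : Real.exp (l * a) * (E a - m / l) ≤ Real.exp (l * t) * E a := by
      have : 0 ≤ m / l := by positivity
      calc Real.exp (l * a) * (E a - m / l) ≤ Real.exp (l * a) * E a := by gcongr; linarith
        _ ≤ _ := by gcongr; exact hE0 a ha
    have h4 := le_of_mul_le_mul_left (h1.trans h3) (Real.exp_pos _)
    linarith
  · have hanti : AntitoneOn (fun τ => E τ - m * τ) (Icc a b) := by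
      have hder : ∀ τ ∈ Ioo a b, HasDerivAt (fun τ => E τ - m * τ) (e τ - m * 1) τ := by
        intro τ hτ
        exact (he τ hτ).sub ((hasDerivAt_id τ).const_mul m)
      refine antitoneOn_of_deriv_nonpos (convex_Icc a b) ?_ ?_ ?_
      · exact hEc.sub (by fun_prop)
      · rw [interior_Icc]
        exact fun τ hτ => (hder τ hτ).differentiableAt.differentiableWithinAt
      · rw [interior_Icc]
        intro τ hτ
        rw [(hder τ hτ).deriv]
        have := hle τ hτ
        have := mul_nonneg hl0.le (hE0 τ (Ioo_subset_Icc_self hτ))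
        linarith
    have h1 := hanti ha ht ht.1
    simp only at h1
    linarith

/-- Bounded linear ODE, global version. -/
lemma linear_ode [CompleteSpace X] {a b : ℝ} (hab : a ≤ b) {L : ℝ → X →L[ℂ] X}
    (hL : SCont (Icc a b) L) {g : ℝ → X} (hg : ContinuousOn g (Icc a b)) (x : X) :
    ∃ u : ℝ → X, u a = x ∧
      ∀ t ∈ Icc a b, HasDerivWithinAt u (L t (u t) + g t) (Icc a b) t := by
  obtain ⟨c, hc0, hc⟩ := hL.1 b
  have hc' : ∀ t ∈ Icc a b, ‖L t‖ ≤ c := fun t ht => hc t ht ht.2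
  set μ : ℝ := 2 * c + 1 with hμ
  have hμ0 : 0 < μ := by positivity
  -- integrand
  set k : C(Icc a b, X) → ℝ → X := fun v r =>
    Real.exp (μ * r) • L (clamp a b r) (v ⟨clamp a b r, clamp_mem hab r⟩) + g (clamp a b r) with hk
  have hvc : ∀ v : C(Icc a b, X), Continuous fun r => v ⟨clamp a b r, clamp_mem hab r⟩ := fun v =>
    v.continuous.comp ((continuous_clamp a b).subtype_mk _)
  have hkc : ∀ v, Continuous (k v) := by
    intro v
    have h1 : Continuous fun r => L (clamp a b r) (v ⟨clamp a b r, clamp_mem hab r⟩) := by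
      have h2 := hL.apply (u := fun r => v ⟨clamp a b r, clamp_mem hab r⟩) (hvc v).continuousOn
      have h3 := continuous_comp_clamp hab h2
      refine h3.congr fun r => ?_
      simp only [clamp_eq (clamp_mem hab r)]
    exact ((by fun_prop : Continuous fun r => Real.exp (μ * r)).smul h1).add
      (continuous_comp_clamp hab hg)
  set I : C(Icc a b, X) → ℝ → X := fun v t => x + ∫ r in a..t, k v r with hI
  have hId : ∀ v t, HasDerivAt (I v) (k v t) t := fun v t =>
    ((hkc v).integral_hasStrictDerivAt a t).hasDerivAt.const_add x
  let Φ : C(Icc a b, X) → C(Icc a b, X) := fun v =>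
    ⟨fun t => Real.exp (-(μ * t)) • I v t, by
      have : Continuous (I v) := continuous_iff_continuousAt.2 fun t => (hId v t).continuousAt
      fun_prop⟩
  have hΦ : ContractingWith (1/2) Φ := by
    refine ⟨by
      rw [← NNReal.coe_lt_coe]; norm_num, LipschitzWith.of_dist_le_mul fun v w => ?_⟩
    rw [ContinuousMap.dist_le (by positivity)]
    intro t
    have hIntg : ∀ v, IntervalIntegrable (k v) volume a t := fun v =>
      (hkc v).intervalIntegrable _ _
    have e1 : Φ v t - Φ w t = Real.exp (-(μ * t)) • ∫ r in a..(t:ℝ), (k v r - k w r) := by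
      rw [intervalIntegral.integral_sub (hIntg v) (hIntg w)]
      simp only [Φ, hI, ContinuousMap.coe_mk, ← smul_sub]
      congr 1; abel
    have e2 : ∀ r, ‖k v r - k w r‖ ≤ Real.exp (μ * r) * (c * dist v w) := by
      intro r
      simp only [hk]
      rw [add_sub_add_right_eq_sub, ← smul_sub, ← map_sub, norm_smul, Real.norm_eq_abs, Real.abs_exp]
      gcongr
      refine ((L _).le_of_opNorm_le (hc' _ (clamp_mem hab r)) _).trans ?_
      gcongr
      rw [← dist_eq_norm]
      exact ContinuousMap.dist_apply_le_dist _
    have e3 : ‖∫ r in a..(t:ℝ), (k v r - k w r)‖ ≤ ∫ r in a..(t:ℝ), Real.exp (μ * r) * (c * dist v w) :=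
      intervalIntegral.norm_integral_le_of_norm_le t.2.1
        (Eventually.of_forall fun r _ => e2 r)
        ((by fun_prop : Continuous fun r => Real.exp (μ * r) * (c * dist v w)).intervalIntegrable _ _)
    have e4 : ∫ r in a..(t:ℝ), Real.exp (μ * r) * (c * dist v w) ≤
        Real.exp (μ * t) / μ * (c * dist v w) := by
      rw [intervalIntegral.integral_mul_const, intervalIntegral.integral_comp_mul_left (fun r => Real.exp r) hμ0.ne', integral_exp,
        smul_eq_mul, ← div_eq_inv_mul]
      have : 0 < Real.exp (μ * a) := Real.exp_pos _
      gcongr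
      linarith
    rw [dist_eq_norm, e1, norm_smul, Real.norm_eq_abs, Real.abs_exp]
    calc _ ≤ Real.exp (-(μ * t)) * (Real.exp (μ * t) / μ * (c * dist v w)) := by
          gcongr; exact e3.trans e4
      _ = (c / μ) * dist v w := by
          rw [Real.exp_neg]; field_simp
      _ ≤ _ := by
          gcongr
          rw [div_le_iff₀ hμ0]
          simp [hμ]; linarith
  set v := hΦ.fixedPoint Φ with hv
  have hfix : Φ v = v := hΦ.fixedPoint_isFixedPt
  refine ⟨I v, by simp [hI], fun t ht => ?_⟩
  have h1 := (hId v t).hasDerivWithinAt (s := Icc a b)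
  convert h1 using 1
  have h2 : v ⟨t, ht⟩ = Real.exp (-(μ * t)) • I v t := by
    conv_lhs => rw [← hfix]
    rfl
  simp only [hk, clamp_eq ht, h2]
  rw [ContinuousLinearMap.map_smul_of_tower, smul_smul, ← Real.exp_add]
  simp


/-- Data for the Yosida-regularised nonautonomous problem on `[a,b]`. -/
structure Sys (a b : ℝ) (A : X →ₗ[ℂ] X) (D : Submodule ℂ X) (J Y : ℕ → X →L[ℂ] X)
    (C C' G G' : ℝ → X →L[ℂ] X) (β γ l : ℝ) : Prop where
  hab : a ≤ b
  md : MaxDiss A D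
  hJD : ∀ n y, J n y ∈ D
  hAJ : ∀ n y, A (J n y) = Y n y
  hYJ : ∀ n y, y - J n y = -((1 / ((n:ℝ) + 1)) • Y n y)
  hYd : ∀ n y, (⟪Y n y, y⟫).re ≤ 0
  hYlim : ∀ x ∈ D, Tendsto (fun n => Y n x) atTop (𝓝 (A x))
  hC : SCont (Icc a b) C
  hCd : SDer (Icc a b) C C'
  hC' : SCont (Icc a b) C'
  hG : SCont (Icc a b) G
  hGd : SDer (Icc a b) G G'
  hGC : ∀ t ∈ Icc a b, ∀ x, G t (C t x) = x
  hCG : ∀ t ∈ Icc a b, ∀ x, C t (G t x) = x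
  hsa : ∀ t ∈ Icc a b, ∀ x y, ⟪G t x, y⟫ = ⟪x, G t y⟫
  hβ : 0 < β
  hco : ∀ t ∈ Icc a b, ∀ x, β * ‖x‖ ^ 2 ≤ (⟪G t x, x⟫).re
  hγ : 0 < γ
  bC' : ∀ t ∈ Icc a b, ‖C' t‖ ≤ γ
  bG : ∀ t ∈ Icc a b, ‖G t‖ ≤ γ
  bG' : ∀ t ∈ Icc a b, ‖G' t‖ ≤ γ
  hl : γ + 1 ≤ l * β
  hθ : γ / √(l * β) * γ ^ 2 ≤ 1 / 2

section SysLemmas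

variable {a b : ℝ} {A : X →ₗ[ℂ] X} {D : Submodule ℂ X} {J Y : ℕ → X →L[ℂ] X}
    {C C' G G' : ℝ → X →L[ℂ] X} {β γ l : ℝ}

/-- Solutions of the regularised problem. -/
def IsSol (a b : ℝ) (Y : ℕ → X →L[ℂ] X) (C : ℝ → X →L[ℂ] X) (l : ℝ) (n : ℕ) (g u : ℝ → X) : Prop :=
  ∀ t ∈ Icc a b, HasDerivWithinAt u (C t (Y n (u t)) - l • u t + g t) (Icc a b) t

lemma IsSol.continuousOn {n : ℕ} {g u : ℝ → X} (h : IsSol a b Y C l n g u) :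
    ContinuousOn u (Icc a b) := fun t ht => (h t ht).continuousWithinAt

lemma IsSol.sub {n : ℕ} {g u g₂ u₂ : ℝ → X} (h : IsSol a b Y C l n g u)
    (h₂ : IsSol a b Y C l n g₂ u₂) :
    IsSol a b Y C l n (fun t => g t - g₂ t) (fun t => u t - u₂ t) := by
  intro t ht
  convert (h t ht).fun_sub (h₂ t ht) using 1
  simp only [map_sub, smul_sub]; abel

lemma IsSol.congr {n : ℕ} {g u g₂ : ℝ → X} (h : IsSol a b Y C l n g u)
    (h₂ : ∀ t ∈ Icc a b, g t = g₂ t) : IsSol a b Y C l n g₂ u := by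
  intro t ht
  rw [← h₂ t ht]; exact h t ht

lemma Sys.l_pos (S : Sys a b A D J Y C C' G G' β γ l) : 0 < l := by
  by_contra hcon
  push Not at hcon
  nlinarith [S.hl, S.hβ, S.hγ]

lemma sqrt_comb {β γ l x y η : ℝ} (hβ : 0 < β) (hγ : 0 < γ) (hl : 0 < l) (hx : 0 ≤ x)
    (hη : 0 ≤ η) (h : β * y ^ 2 ≤ γ * x ^ 2 + (γ * η) ^ 2 / l) :
    y ≤ √(γ / β) * x + γ / √(l * β) * η := by
  have h1 : √(γ / β) ^ 2 = γ / β := Real.sq_sqrt (by positivity)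
  have h2 : √(l * β) ^ 2 = l * β := Real.sq_sqrt (by positivity)
  have h2p : 0 < √(l * β) := Real.sqrt_pos.2 (by positivity)
  refine abs_le_of_sq_le_sq' ?_ ?_ |>.2
  · have e1 : (√(γ / β) * x) ^ 2 = γ * x ^ 2 / β := by rw [mul_pow, h1]; ring
    have e2 : (γ / √(l * β) * η) ^ 2 = (γ * η) ^ 2 / l / β := by
      rw [mul_pow, div_pow, h2]; field_simp
    have e3 : y ^ 2 ≤ γ * x ^ 2 / β + (γ * η) ^ 2 / l / β := by
      rw [← add_div, le_div_iff₀ hβ]; linarith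
    have e4 : 0 ≤ (√(γ / β) * x) * (γ / √(l * β) * η) := by positivity
    nlinarith
  · positivity

lemma Sys.est [CompleteSpace X] (S : Sys a b A D J Y C C' G G' β γ l) {n : ℕ} {g u : ℝ → X} {η : ℝ}
    (hη : 0 ≤ η) (hu : IsSol a b Y C l n g u) (hg : ∀ t ∈ Icc a b, ‖g t‖ ≤ η) :
    ∀ t ∈ Icc a b, ‖u t‖ ≤ √(γ / β) * ‖u a‖ + γ / √(l * β) * η := by
  intro t ht
  have hl0 := S.l_pos
  have ha : a ∈ Icc a b := ⟨le_rfl, S.hab⟩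
  have h1 := (energy S.hG S.hGd S.hβ S.hγ.le S.hco S.bG' S.hsa S.hl hu.continuousOn
    (u' := fun t => C t (Y n (u t)) - l • u t + g t)
    (fun t ht => (hu t (Ioo_subset_Icc_self ht)).hasDerivAt (Icc_mem_nhds ht.1 ht.2))
    (η := γ * η) (ρ := 0) le_rfl (by
      intro t ht
      have ht' := Ioo_subset_Icc_self ht
      rw [map_add, map_sub, S.hGC t ht', ContinuousLinearMap.map_smul_of_tower, inner_add_left,
        inner_sub_left, Complex.add_re, Complex.sub_re, re_inner_real_smul_left]
      have e1 := S.hYd n (u t)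
      have e2 : (⟪G t (g t), u t⟫).re ≤ γ * η * ‖u t‖ := by
        refine (re_inner_le _ _).trans ?_
        gcongr
        exact (G t).le_of_opNorm_le_of_le (S.bG t ht') (hg t ht')
      linarith) t ht).1
  apply sqrt_comb S.hβ S.hγ hl0 (norm_nonneg _) hη
  have h2 := S.hco t ht (u t)
  have h3 : (⟪G a (u a), u a⟫).re ≤ γ * ‖u a‖ ^ 2 := by
    refine (re_inner_le _ _).trans ?_
    have := (G a).le_of_opNorm_le (S.bG a ha) (u a)
    nlinarith [norm_nonneg (u a)]
  rw [mul_zero, add_zero] at h1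
  linarith

lemma Sys.est2 [CompleteSpace X] (S : Sys a b A D J Y C C' G G' β γ l) {n : ℕ} {g u : ℝ → X} {κ k : ℝ}
    (hκ : 0 ≤ κ) (hk : 0 ≤ k) (hκθ : γ / √(l * β) * κ ≤ 1 / 2)
    (hu : IsSol a b Y C l n g u) (hg : ∀ t ∈ Icc a b, ‖g t‖ ≤ κ * ‖u t‖ + k) :
    ∀ t ∈ Icc a b, ‖u t‖ ≤ 2 * (√(γ / β) * ‖u a‖ + γ / √(l * β) * k) := by
  obtain ⟨t₀, ht₀, hmax⟩ := isCompact_Icc.exists_isMaxOn (nonempty_Icc.2 S.hab)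
    hu.continuousOn.norm
  have hmax' : ∀ t ∈ Icc a b, ‖u t‖ ≤ ‖u t₀‖ := fun t ht => hmax ht
  have h1 := S.est (η := κ * ‖u t₀‖ + k) (by positivity) hu (fun t ht => (hg t ht).trans (by
    gcongr; exact hmax' t ht)) t₀ ht₀
  intro t ht
  refine (hmax' t ht).trans ?_
  have h2 := mul_le_mul_of_nonneg_right hκθ (norm_nonneg (u t₀))
  nlinarith

lemma Sys.exists_sol [CompleteSpace X] (S : Sys a b A D J Y C C' G G' β γ l) (n : ℕ) {g : ℝ → X}
    (hg : ContinuousOn g (Icc a b)) (x : X) : ∃ u, u a = x ∧ IsSol a b Y C l n g u := by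
  obtain ⟨u, hu, hd⟩ := linear_ode S.hab (L := fun t => (C t).comp (Y n) + -(l • (1 : X →L[ℂ] X)))
    ((S.hC.comp (SCont.const (Y n))).add (SCont.const _).neg) hg x
  refine ⟨u, hu, fun t ht => ?_⟩
  convert hd t ht using 1
  simp [sub_eq_add_neg]

/-- Cauchy property for smooth data. -/
lemma Sys.cauchy_smooth [CompleteSpace X] (S : Sys a b A D J Y C C' G G' β γ l) {g g' : ℝ → X}
    (hg : ∀ t ∈ Icc a b, HasDerivWithinAt g (g' t) (Icc a b) t)
    (hg' : ContinuousOn g' (Icc a b)) {x : X} (hx : x ∈ D) {u : ℕ → ℝ → X}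
    (hux : ∀ n, u n a = x) (hu : ∀ n, IsSol a b Y C l n g (u n)) :
    ∃ B : ℝ, 0 ≤ B ∧ ∀ n m : ℕ, ∀ t ∈ Icc a b,
      ‖u n t - u m t‖ ^ 2 ≤ B * (1 / ((n:ℝ) + 1) + 1 / ((m:ℝ) + 1)) := by
  have hl0 := S.l_pos
  have hβ := S.hβ
  have hγ := S.hγ
  have ha : a ∈ Icc a b := ⟨le_rfl, S.hab⟩
  have hgc : ContinuousOn g (Icc a b) := fun t ht => (hg t ht).continuousWithinAt
  obtain ⟨b₁, hb₁⟩ := isCompact_Icc.exists_bound_of_continuousOn hgc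
  obtain ⟨b₂, hb₂⟩ := isCompact_Icc.exists_bound_of_continuousOn hg'
  have hb₁0 : 0 ≤ b₁ := (norm_nonneg _).trans (hb₁ a ha)
  have hb₂0 : 0 ≤ b₂ := (norm_nonneg _).trans (hb₂ a ha)
  obtain ⟨b₃, hb₃⟩ := (S.hYlim x hx).norm.bddAbove_range
  have hb₃' : ∀ n, ‖Y n x‖ ≤ b₃ := fun n => hb₃ ⟨n, rfl⟩
  have hb₃0 : 0 ≤ b₃ := (norm_nonneg _).trans (hb₃' 0)
  -- bound on u
  set U := √(γ / β) * ‖x‖ + γ / √(l * β) * b₁ with hU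
  have hU0 : 0 ≤ U := by positivity
  have hub : ∀ n, ∀ t ∈ Icc a b, ‖u n t‖ ≤ U := fun n t ht => by
    have := S.est hb₁0 (hu n) hb₁ t ht
    rwa [hux n] at this
  -- the derivative
  set w : ℕ → ℝ → X := fun n t => C t (Y n (u n t)) - l • u n t + g t with hw
  have hYw : ∀ n, ∀ t ∈ Icc a b, Y n (u n t) = G t (w n t + l • u n t - g t) := by
    intro n t ht
    simp only [hw]
    rw [show C t (Y n (u n t)) - l • u n t + g t + l • u n t - g t = C t (Y n (u n t)) by abel,
      S.hGC t ht]
  have hYb : ∀ n, ∀ t ∈ Icc a b, ‖Y n (u n t)‖ ≤ γ * (‖w n t‖ + l * U + b₁) := by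
    intro n t ht
    rw [hYw n t ht]
    refine (G t).le_of_opNorm_le_of_le (S.bG t ht) ?_
    refine (norm_sub_le _ _).trans (add_le_add ((norm_add_le _ _).trans (add_le_add le_rfl ?_))
      (hb₁ t ht))
    rw [norm_smul, Real.norm_eq_abs, abs_of_pos hl0]
    gcongr
    exact hub n t ht
  have hws : ∀ n, IsSol a b Y C l n (fun t => C' t (Y n (u n t)) + g' t) (w n) := by
    intro n t ht
    have h1 := hu n t ht
    have h2 : HasDerivWithinAt (fun τ => Y n (u n τ)) (Y n (w n t)) (Icc a b) t :=
      ((Y n).restrictScalars ℝ).hasFDerivAt.comp_hasDerivWithinAt t h1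
    have h3 := (((S.hCd.apply S.hC ht h2).fun_sub (h1.fun_const_smul l)).fun_add (hg t ht))
    convert h3 using 1
    simp only [hw]; abel
  set k := γ ^ 2 * (l * U + b₁) + b₂ with hk
  have hk0 : 0 ≤ k := by positivity
  have hwb := fun n => S.est2 (κ := γ ^ 2) (k := k) (by positivity) hk0 S.hθ (hws n) (by
    intro t ht
    refine (norm_add_le _ _).trans ?_
    have h1 := (C' t).le_of_opNorm_le_of_le (S.bC' t ht) (hYb n t ht)
    have h2 := hb₂ t ht
    calc _ ≤ γ * (γ * (‖w n t‖ + l * U + b₁)) + b₂ := add_le_add h1 h2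
      _ = _ := by rw [hk]; ring)
  obtain ⟨cC, hcC0, hcC⟩ := S.hC.1 b
  set Wm := 2 * (√(γ / β) * (cC * b₃ + l * ‖x‖ + b₁) + γ / √(l * β) * k) with hWm
  have hwb' : ∀ n, ∀ t ∈ Icc a b, ‖w n t‖ ≤ Wm := by
    intro n t ht
    refine (hwb n t ht).trans ?_
    rw [hWm]
    gcongr
    simp only [hw, hux]
    refine (norm_add_le _ _).trans (add_le_add ((norm_sub_le _ _).trans (add_le_add ?_ ?_))
      (hb₁ a ha))
    · exact (C a).le_of_opNorm_le_of_le (hcC a ha S.hab) (hb₃' n)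
    · rw [norm_smul, Real.norm_eq_abs, abs_of_pos hl0]
  have hWm0 : 0 ≤ Wm := (norm_nonneg _).trans (hwb' 0 a ha)
  set N := γ * (Wm + l * U + b₁) with hN
  have hN0 : 0 ≤ N := by positivity
  have hYN : ∀ n, ∀ t ∈ Icc a b, ‖Y n (u n t)‖ ≤ N := fun n t ht =>
    (hYb n t ht).trans (by rw [hN]; gcongr; exact hwb' n t ht)
  refine ⟨4 * N ^ 2 / (l * β), by positivity, fun n m t ht => ?_⟩
  set δ := 1 / ((n:ℝ) + 1) + 1 / ((m:ℝ) + 1) with hδ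
  have hδ0 : 0 ≤ δ := by positivity
  have h1 := (energy S.hG S.hGd S.hβ S.hγ.le S.hco S.bG' S.hsa S.hl
    (u := fun t => u n t - u m t)
    ((hu n).continuousOn.sub (hu m).continuousOn)
    (u' := fun t => (C t (Y n (u n t)) - l • u n t + g t) - (C t (Y m (u m t)) - l • u m t + g t))
    (fun t ht => ((hu n t (Ioo_subset_Icc_self ht)).hasDerivAt (Icc_mem_nhds ht.1 ht.2)).sub
      ((hu m t (Ioo_subset_Icc_self ht)).hasDerivAt (Icc_mem_nhds ht.1 ht.2)))
    (η := 0) (ρ := 2 * N ^ 2 * δ) (by positivity) (by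
      intro t ht
      have ht' := Ioo_subset_Icc_self ht
      have e0 : (C t (Y n (u n t)) - l • u n t + g t) - (C t (Y m (u m t)) - l • u m t + g t)
        = (C t (Y n (u n t) - Y m (u m t))) - l • (u n t - u m t) := by
        rw [map_sub, smul_sub]; abel
      rw [e0, map_sub, S.hGC t ht', ContinuousLinearMap.map_smul_of_tower,
        inner_sub_left, Complex.sub_re, re_inner_real_smul_left]
      have e1 : u n t - u m t = (J n (u n t) - J m (u m t)) +
          ((1 / ((m:ℝ) + 1)) • Y m (u m t) - (1 / ((n:ℝ) + 1)) • Y n (u n t)) := by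
        have q1 := S.hYJ n (u n t)
        have q2 := S.hYJ m (u m t)
        rw [sub_eq_iff_eq_add] at q1 q2
        nth_rw 1 [q1, q2]; abel
      have e2 : (⟪Y n (u n t) - Y m (u m t), J n (u n t) - J m (u m t)⟫).re ≤ 0 := by
        rw [← S.hAJ, ← S.hAJ, ← map_sub]
        exact S.md.diss _ (D.sub_mem (S.hJD _ _) (S.hJD _ _))
      have e3 : (⟪Y n (u n t) - Y m (u m t),
          (1 / ((m:ℝ) + 1)) • Y m (u m t) - (1 / ((n:ℝ) + 1)) • Y n (u n t)⟫).re
          ≤ (N + N) * (1 / ((m:ℝ) + 1) * N + 1 / ((n:ℝ) + 1) * N) := by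
        refine (re_inner_le _ _).trans ?_
        have p1 : (0:ℝ) < 1 / ((m:ℝ) + 1) := by positivity
        have p2 : (0:ℝ) < 1 / ((n:ℝ) + 1) := by positivity
        gcongr
        · exact (norm_sub_le _ _).trans (add_le_add (hYN n t ht') (hYN m t ht'))
        · refine (norm_sub_le _ _).trans (add_le_add ?_ ?_)
          · rw [norm_smul, Real.norm_eq_abs, abs_of_pos p1]; gcongr; exact hYN m t ht'
          · rw [norm_smul, Real.norm_eq_abs, abs_of_pos p2]; gcongr; exact hYN n t ht'
      have e4 : (⟪Y n (u n t) - Y m (u m t), u n t - u m t⟫).re ≤ 2 * N ^ 2 * δ := by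
        rw [e1, inner_add_right, Complex.add_re]
        calc _ ≤ 0 + (N + N) * (1 / ((m:ℝ) + 1) * N + 1 / ((n:ℝ) + 1) * N) := add_le_add e2 e3
          _ = _ := by rw [hδ]; ring
      linarith) t ht).1
  have h2 := S.hco t ht (u n t - u m t)
  simp only [hux, sub_self, map_zero, inner_zero_left, Complex.zero_re] at h1
  have h3 := h2.trans h1
  rw [← le_div_iff₀' hβ] at h3
  refine h3.trans (le_of_eq ?_)
  field_simp; ring

end SysLemmas


/-- Uniform `C¹` approximation of continuous functions on a compact interval. -/
lemma exists_C1_approx [CompleteSpace X] {a b : ℝ} (hab : a ≤ b) {g : ℝ → X}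
    (hg : ContinuousOn g (Icc a b)) {δ : ℝ} (hδ : 0 < δ) :
    ∃ g₁ g₁' : ℝ → X, (∀ t ∈ Icc a b, HasDerivWithinAt g₁ (g₁' t) (Icc a b) t) ∧
      ContinuousOn g₁' (Icc a b) ∧ ∀ t ∈ Icc a b, ‖g t - g₁ t‖ ≤ δ := by
  set f : ℝ → X := fun t => g (clamp a b t) with hf
  have hfc : Continuous f := continuous_comp_clamp hab hg
  have huc := isCompact_Icc.uniformContinuousOn_of_continuous hg
  rw [Metric.uniformContinuousOn_iff] at huc
  obtain ⟨h, hh, hh2⟩ := huc δ hδ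
  have hcl : ∀ s t : ℝ, |clamp a b s - clamp a b t| ≤ |s - t| := by
    intro s t
    unfold clamp
    refine (abs_max_sub_max_le_max _ _ _ _).trans ?_
    refine max_le (by simp) ((abs_min_sub_min_le_max _ _ _ _).trans ?_)
    exact max_le (by simp) le_rfl
  have hfu : ∀ s t : ℝ, |s - t| < h → ‖f s - f t‖ ≤ δ := by
    intro s t hst
    rw [← dist_eq_norm]
    exact (hh2 _ (clamp_mem hab s) _ (clamp_mem hab t)
      (by rw [Real.dist_eq]; exact (hcl s t).trans_lt hst)).le
  set k := h / 2 with hk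
  have hk0 : 0 < k := by positivity
  have hi : ∀ s t : ℝ, IntervalIntegrable f volume s t := fun s t => hfc.intervalIntegrable s t
  have hΦ : ∀ t, HasDerivAt (fun t => ∫ r in (0:ℝ)..t, f r) (f t) t := fun t =>
    intervalIntegral.integral_hasDerivAt_right (hi _ _)
      hfc.aestronglyMeasurable.stronglyMeasurableAtFilter hfc.continuousAt
  refine ⟨fun t => k⁻¹ • ((∫ r in (0:ℝ)..(t + k), f r) - ∫ r in (0:ℝ)..t, f r),
    fun t => k⁻¹ • (f (t + k) - f t), fun t _ => ?_, ?_, fun t ht => ?_⟩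
  · have h1 := (hΦ (t + k)).comp_add_const t k
    exact ((h1.sub (hΦ t)).const_smul _).hasDerivWithinAt
  · exact (by fun_prop : Continuous fun t => k⁻¹ • (f (t + k) - f t)).continuousOn
  · have e1 : g t = k⁻¹ • ∫ r in t..(t + k), f t := by
      rw [intervalIntegral.integral_const, add_sub_cancel_left, smul_smul,
        inv_mul_cancel₀ hk0.ne', one_smul, hf]
      simp only [clamp_eq ht]
    have e2 : (∫ r in (0:ℝ)..(t + k), f r) - ∫ r in (0:ℝ)..t, f r = ∫ r in t..(t + k), f r :=
      intervalIntegral.integral_interval_sub_left (hi _ _) (hi _ _)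
    beta_reduce
    rw [e2, e1, ← smul_sub, ← intervalIntegral.integral_sub intervalIntegrable_const (hi _ _),
      norm_smul, norm_inv, Real.norm_eq_abs, abs_of_pos hk0]
    have e3 : ‖∫ r in t..(t + k), (f t - f r)‖ ≤ δ * |t + k - t| := by
      refine intervalIntegral.norm_integral_le_of_norm_le_const fun r hr => hfu _ _ ?_
      rw [uIoc_of_le (by linarith)] at hr
      rw [abs_lt]; constructor <;> linarith [hr.1, hr.2]
    rw [add_sub_cancel_left, abs_of_pos hk0] at e3
    rw [inv_mul_le_iff₀ hk0]; linarith

section SysLemmas2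

variable [CompleteSpace X] {a b : ℝ} {A : X →ₗ[ℂ] X} {D : Submodule ℂ X} {J Y : ℕ → X →L[ℂ] X}
    {C C' G G' : ℝ → X →L[ℂ] X} {β γ l : ℝ}

lemma Sys.conv2 (S : Sys a b A D J Y C C' G G' β γ l) {g : ℝ → X}
    (hg : ContinuousOn g (Icc a b)) (x : X) {u : ℕ → ℝ → X}
    (hux : ∀ n, u n a = x) (hu : ∀ n, IsSol a b Y C l n g (u n)) :
    ∃ v, ContinuousOn v (Icc a b) ∧ TendstoUniformlyOn u v atTop (Icc a b) := by
  have hl0 := S.l_pos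
  have hβ := S.hβ
  have hγ := S.hγ
  have hc : UniformCauchySeqOn u atTop (Icc a b) := by
    rw [Metric.uniformCauchySeqOn_iff]
    intro ε hε
    set c₁ := √(γ / β) with hc₁
    set c₂ := γ / √(l * β) with hc₂
    have hc₁0 : 0 ≤ c₁ := by positivity
    have hc₂0 : 0 ≤ c₂ := by positivity
    set δ := ε / (4 * (c₁ + c₂ + 1)) with hδ
    have hδ0 : 0 < δ := by positivity
    obtain ⟨x₁, hx₁, hxx⟩ := Metric.dense_iff.1 S.md.dense x δ hδ0
    obtain ⟨g₁, g₁', hg₁, hg₁', hgg⟩ := exists_C1_approx S.hab hg hδ0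
    have hg₁c : ContinuousOn g₁ (Icc a b) := fun t ht => (hg₁ t ht).continuousWithinAt
    choose v hvx hv using fun n => S.exists_sol n hg₁c x₁
    obtain ⟨B, hB, hvc⟩ := S.cauchy_smooth hg₁ hg₁' hxx hvx hv
    have hclose : ∀ n, ∀ t ∈ Icc a b, ‖u n t - v n t‖ ≤ ε / 4 := by
      intro n t ht
      have h1 := S.est hδ0.le ((hu n).sub (hv n)) hgg t ht
      rw [hux, hvx] at h1
      have h2 : ‖x - x₁‖ ≤ δ := by
        rw [← dist_eq_norm, dist_comm]; exact (Metric.mem_ball.1 hx₁).le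
      have h3 : c₁ * ‖x - x₁‖ ≤ c₁ * δ := by gcongr
      have h4 : (c₁ + c₂ + 1) * δ = ε / 4 := by rw [hδ]; field_simp
      have h5 : ‖u n t - v n t‖ ≤ c₁ * ‖x - x₁‖ + c₂ * δ := h1
      nlinarith
    obtain ⟨N, hN⟩ := exists_nat_gt (2 * B / (ε / 4) ^ 2)
    refine ⟨N, fun m hm n hn t ht => ?_⟩
    have h6 : ‖v m t - v n t‖ ≤ ε / 4 := by
      refine abs_le_of_sq_le_sq' ?_ (by positivity) |>.2
      refine (hvc m n t ht).trans ?_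
      have h7 : 2 * B < N * (ε / 4) ^ 2 := by rwa [div_lt_iff₀ (by positivity)] at hN
      have hN0 : (0:ℝ) ≤ N := by positivity
      have h8 : 1 / ((m:ℝ) + 1) ≤ 1 / ((N:ℝ) + 1) := by gcongr
      have h9 : 1 / ((n:ℝ) + 1) ≤ 1 / ((N:ℝ) + 1) := by gcongr
      calc B * (1 / ((m:ℝ) + 1) + 1 / ((n:ℝ) + 1)) ≤ B * (1 / ((N:ℝ) + 1) + 1 / ((N:ℝ) + 1)) := by
            gcongr
        _ = 2 * B / ((N:ℝ) + 1) := by ring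
        _ ≤ (ε / 4) ^ 2 := by
            rw [div_le_iff₀ (by positivity)]; nlinarith [sq_nonneg (ε / 4)]
    rw [dist_eq_norm]
    have e : u m t - u n t = (u m t - v m t) + (v m t - v n t) - (u n t - v n t) := by abel
    rw [e]
    have h10 := norm_sub_le ((u m t - v m t) + (v m t - v n t)) (u n t - v n t)
    have h11 := norm_add_le (u m t - v m t) (v m t - v n t)
    linarith [hclose m t ht, hclose n t ht]
  have hlim : ∀ t, ∃ y, t ∈ Icc a b → Tendsto (fun n => u n t) atTop (𝓝 y) := by
    intro t
    by_cases ht : t ∈ Icc a b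
    · obtain ⟨y, hy⟩ := cauchySeq_tendsto_of_complete (hc.cauchySeq ht)
      exact ⟨y, fun _ => hy⟩
    · exact ⟨0, fun h => absurd h ht⟩
  choose v hv using hlim
  have hT := hc.tendstoUniformlyOn_of_tendsto hv
  exact ⟨v, hT.continuousOn (Frequently.of_forall fun n => (hu n).continuousOn), hT⟩

/-- Convergence for the perturbed problem. -/
lemma Sys.conv3 (S : Sys a b A D J Y C C' G G' β γ l) {K : ℝ → X →L[ℂ] X} {κ : ℝ}
    (hK : SCont (Icc a b) K) (hκ : 0 ≤ κ) (hKκ : ∀ t ∈ Icc a b, ‖K t‖ ≤ κ)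
    (hθκ : γ / √(l * β) * κ ≤ 1 / 2) {g : ℝ → X} (hg : ContinuousOn g (Icc a b)) {x : X}
    {v gn : ℕ → ℝ → X} (hvx : Tendsto (fun n => v n a) atTop (𝓝 x))
    (hgn : TendstoUniformlyOn gn g atTop (Icc a b))
    (hv : ∀ n, IsSol a b Y C l n (fun t => K t (v n t) + gn n t) (v n)) :
    ∃ w, ContinuousOn w (Icc a b) ∧ TendstoUniformlyOn v w atTop (Icc a b) := by
  have hl0 := S.l_pos
  have hβ := S.hβ
  have hγ := S.hγ
  have ha : a ∈ Icc a b := ⟨le_rfl, S.hab⟩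
  have : Nonempty (Icc a b) := ⟨⟨a, ha⟩⟩
  -- extension
  let ext : C(Icc a b, X) → ℝ → X := fun φ t => φ ⟨clamp a b t, clamp_mem S.hab t⟩
  have hext : ∀ φ, Continuous (ext φ) := fun φ =>
    φ.continuous.comp ((continuous_clamp a b).subtype_mk _)
  have hsrc : ∀ φ, ContinuousOn (fun t => K t (ext φ t) + g t) (Icc a b) := fun φ =>
    (hK.apply (hext φ).continuousOn).add hg
  choose s hsx hs using fun φ n => S.exists_sol n (hsrc φ) x
  choose L hLc hL using fun φ => S.conv2 (hsrc φ) x (hsx φ) (hs φ)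
  let Φ : C(Icc a b, X) → C(Icc a b, X) := fun φ =>
    ⟨(Icc a b).domRestrict (L φ), continuousOn_iff_continuous_domRestrict.1 (hLc φ)⟩
  have hcon : ContractingWith (1 / 2) Φ := by
    refine ⟨by rw [← NNReal.coe_lt_coe]; norm_num, LipschitzWith.of_dist_le_mul fun φ ψ => ?_⟩
    rw [ContinuousMap.dist_le (by positivity)]
    rintro ⟨t, ht⟩
    have hp : ∀ n, ‖s φ n t - s ψ n t‖ ≤ 1 / 2 * dist φ ψ := by
      intro n
      have h1 := S.est (η := κ * dist φ ψ) (by positivity) ((hs φ n).sub (hs ψ n)) (by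
        intro r hr
        have e : K r (ext φ r) + g r - (K r (ext ψ r) + g r) = K r (ext φ r - ext ψ r) := by
          rw [map_sub]; abel
        rw [e]
        refine (K r).le_of_opNorm_le_of_le (hKκ r hr) ?_
        rw [← dist_eq_norm]
        exact ContinuousMap.dist_apply_le_dist _) t ht
      rw [hsx, hsx, sub_self, norm_zero, mul_zero, zero_add, ← mul_assoc] at h1
      refine h1.trans ?_
      gcongr
    have h2 : Tendsto (fun n => ‖s φ n t - s ψ n t‖) atTop (𝓝 ‖L φ t - L ψ t‖) :=
      (((hL φ).tendsto_at ht).sub ((hL ψ).tendsto_at ht)).norm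
    have h3 := le_of_tendsto' h2 hp
    rw [dist_eq_norm]
    have e5 : ((1 / 2 : NNReal) : ℝ) = 1 / 2 := by norm_num
    rw [e5]; exact h3
  set w := ContractingWith.fixedPoint Φ hcon with hw
  have hfix : Φ w = w := hcon.fixedPoint_isFixedPt
  have hLw : ∀ t ∈ Icc a b, L w t = ext w t := by
    intro t ht
    have := congrArg (fun φ : C(Icc a b, X) => φ ⟨t, ht⟩) hfix
    simp only [ext, clamp_eq ht]
    exact this
  refine ⟨L w, hLc w, ?_⟩
  rw [Metric.tendstoUniformlyOn_iff]
  intro ε hε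
  set c₁ := √(γ / β) with hc₁
  set c₂ := γ / √(l * β) with hc₂
  have hc₁0 : 0 ≤ c₁ := by positivity
  have hc₂0 : 0 ≤ c₂ := by positivity
  set δ := ε / (4 * (c₁ + c₂ * (κ + 1) + 1)) with hδ
  have hδ0 : 0 < δ := by positivity
  have hδε : δ ≤ ε / 4 := by
    rw [hδ]
    apply div_le_div_of_nonneg_left hε.le (by norm_num)
    nlinarith [mul_nonneg hc₂0 (by positivity : 0 ≤ κ + 1)]
  filter_upwards [Metric.tendstoUniformlyOn_iff.1 (hL w) δ hδ0,
    Metric.tendstoUniformlyOn_iff.1 hgn δ hδ0, Metric.tendsto_nhds.1 hvx δ hδ0] with n h1 h2 h3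
  intro t ht
  have h4 := S.est2 (κ := κ) (k := κ * δ + δ) hκ (by positivity) hθκ ((hv n).sub (hs w n)) (by
    intro r hr
    have e : K r (v n r) + gn n r - (K r (ext w r) + g r) =
        K r (v n r - s w n r) + K r (s w n r - L w r) + (gn n r - g r) := by
      rw [map_sub, map_sub, hLw r hr]; abel
    rw [e]
    have f1 := (K r).le_of_opNorm_le (hKκ r hr) (v n r - s w n r)
    have f2 : ‖K r (s w n r - L w r)‖ ≤ κ * δ := by
      refine (K r).le_of_opNorm_le_of_le (hKκ r hr) ?_
      rw [← dist_eq_norm, dist_comm]; exact (h1 r hr).le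
    have f3 : ‖gn n r - g r‖ ≤ δ := by
      rw [← dist_eq_norm, dist_comm]; exact (h2 r hr).le
    have f4 := norm_add_le (K r (v n r - s w n r) + K r (s w n r - L w r)) (gn n r - g r)
    have f5 := norm_add_le (K r (v n r - s w n r)) (K r (s w n r - L w r))
    linarith) t ht
  rw [hsx, ← hc₁, ← hc₂] at h4
  have h5 : ‖v n a - x‖ ≤ δ := by rw [← dist_eq_norm]; exact h3.le
  have h6 : c₁ * ‖v n a - x‖ ≤ c₁ * δ := by gcongr
  have h7 : (c₁ + c₂ * (κ + 1) + 1) * δ = ε / 4 := by rw [hδ]; field_simp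
  have h8 : ‖s w n t - L w t‖ < δ := by rw [← dist_eq_norm, dist_comm]; exact h1 t ht
  rw [dist_comm, dist_eq_norm]
  have e : v n t - L w t = (v n t - s w n t) + (s w n t - L w t) := by abel
  rw [e]
  have h9 := norm_add_le (v n t - s w n t) (s w n t - L w t)
  nlinarith

end SysLemmas2


lemma SCont.tendstoUniformlyOn {a b : ℝ} {H : ℝ → X →L[ℂ] X} (hH : SCont (Icc a b) H)
    {z : ℕ → ℝ → X} {w : ℝ → X} (h : TendstoUniformlyOn z w atTop (Icc a b)) :
    TendstoUniformlyOn (fun n t => H t (z n t)) (fun t => H t (w t)) atTop (Icc a b) := by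
  obtain ⟨c, hc0, hc⟩ := hH.1 b
  rw [Metric.tendstoUniformlyOn_iff] at h ⊢
  intro ε hε
  filter_upwards [h (ε / (c + 1)) (by positivity)] with n hn t ht
  have h1 := hn t ht
  rw [dist_eq_norm] at h1 ⊢
  rw [← map_sub]
  refine ((H t).le_of_opNorm_le (hc t ht ht.2) _).trans_lt ?_
  rw [lt_div_iff₀ (by positivity)] at h1
  nlinarith [norm_nonneg (w t - z n t)]

set_option linter.unusedSectionVars false

lemma tendstoUniformlyOn_add {s : Set ℝ} {u v : ℕ → ℝ → X} {p q : ℝ → X}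
    (h : TendstoUniformlyOn u p atTop s) (h' : TendstoUniformlyOn v q atTop s) :
    TendstoUniformlyOn (fun n t => u n t + v n t) (fun t => p t + q t) atTop s := h.add h'

lemma tendstoUniformlyOn_const {s : Set ℝ} (q : ℝ → X) :
    TendstoUniformlyOn (fun (_ : ℕ) t => q t) q atTop s := by
  rw [Metric.tendstoUniformlyOn_iff]
  intro ε hε
  filter_upwards with n t _
  simpa using hε

/-- Uniform limits of derivatives on a compact interval. -/
lemma hasDerivWithinAt_of_uniform [CompleteSpace X] {a b : ℝ} (hab : a ≤ b) {z w : ℕ → ℝ → X} {p q : ℝ → X}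
    (hz : ∀ n, ∀ t ∈ Icc a b, HasDerivWithinAt (z n) (w n t) (Icc a b) t)
    (hp : ∀ t ∈ Icc a b, Tendsto (fun n => z n t) atTop (𝓝 (p t)))
    (hw : TendstoUniformlyOn w q atTop (Icc a b)) (hq : ContinuousOn q (Icc a b)) :
    ∀ t ∈ Icc a b, HasDerivWithinAt p (q t) (Icc a b) t := by
  have hqc := continuous_comp_clamp hab hq
  set P : ℝ → X := fun t => p a + ∫ r in a..t, q (clamp a b r) with hP
  have hPd : ∀ t, HasDerivAt P (q (clamp a b t)) t := fun t =>
    (intervalIntegral.integral_hasDerivAt_right (hqc.intervalIntegrable _ _)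
      hqc.aestronglyMeasurable.stronglyMeasurableAtFilter hqc.continuousAt).const_add _
  have ha : a ∈ Icc a b := ⟨le_rfl, hab⟩
  have hPa : P a = p a := by simp [hP]
  have heq : ∀ t ∈ Icc a b, p t = P t := by
    intro t ht
    have h1 : Tendsto (fun n => ‖(z n t - P t) - (z n a - P a)‖) atTop
        (𝓝 ‖(p t - P t) - (p a - P a)‖) :=
      (((hp t ht).sub_const _).sub ((hp a ha).sub_const _)).norm
    have h2 : ‖(p t - P t) - (p a - P a)‖ ≤ 0 := by
      apply le_of_forall_pos_le_add
      intro ε hε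
      refine le_of_tendsto h1 ?_
      filter_upwards [Metric.tendstoUniformlyOn_iff.1 hw (ε / (b - a + 1))
        (by have := sub_nonneg.2 hab; positivity)] with n hn
      have hba := sub_nonneg.2 hab
      have h3 := norm_image_sub_le_of_norm_deriv_le_segment'
        (f := fun t => z n t - P t) (f' := fun t => w n t - q (clamp a b t))
        (C := ε / (b - a + 1)) (fun r hr => (hz n r hr).fun_sub (hPd r).hasDerivWithinAt)
        (fun r hr => by
          rw [clamp_eq (Ico_subset_Icc_self hr), ← dist_eq_norm, dist_comm]
          exact (hn r (Ico_subset_Icc_self hr)).le) t ht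
      refine h3.trans ?_
      rw [zero_add, div_mul_eq_mul_div, div_le_iff₀ (by positivity)]
      have := ht.2
      gcongr
      linarith
    have h4 := norm_le_zero_iff.1 h2
    rw [hPa, sub_self, sub_zero, sub_eq_zero] at h4
    exact h4
  intro t ht
  have h5 := (hPd t).hasDerivWithinAt (s := Icc a b)
  rw [clamp_eq ht] at h5
  exact h5.congr heq (heq t ht)

lemma Sys.exists_core [CompleteSpace X] {a b : ℝ} {A : X →ₗ[ℂ] X} {D : Submodule ℂ X}
    {J Y : ℕ → X →L[ℂ] X} {C C' G G' : ℝ → X →L[ℂ] X} {β γ l : ℝ}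
    (S : Sys a b A D J Y C C' G G' β γ l) {Q Q' : ℝ → X →L[ℂ] X} {κ : ℝ}
    (hQ : SCont (Icc a b) Q) (hQd : SDer (Icc a b) Q Q') (hQ' : SCont (Icc a b) Q')
    (hκ : 0 ≤ κ) (b1 : ∀ t ∈ Icc a b, ‖Q t‖ ≤ κ)
    (b2 : ∀ t ∈ Icc a b, ‖Q t + (C' t).comp (G t)‖ ≤ κ)
    (hθκ : γ / √(l * β) * κ ≤ 1 / 2) {f f' : ℝ → X}
    (hf : ∀ t ∈ Icc a b, HasDerivWithinAt f (f' t) (Icc a b) t)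
    (hf' : ContinuousOn f' (Icc a b)) {z₀ : X} (hz₀ : z₀ ∈ D) :
    ∃ z q : ℝ → X, z a = z₀ ∧ (∀ t ∈ Icc a b, z t ∈ D) ∧ ContinuousOn q (Icc a b) ∧
      (∀ t ∈ Icc a b, HasDerivWithinAt z (q t) (Icc a b) t) ∧
      (∀ t ∈ Icc a b, q t = C t (A (z t)) - l • z t + Q t (z t) + f t) := by
  have ha : a ∈ Icc a b := ⟨le_rfl, S.hab⟩
  have hfc : ContinuousOn f (Icc a b) := fun t ht => (hf t ht).continuousWithinAt
  -- approximations
  have hex : ∀ n, ∃ u, u a = z₀ ∧ IsSol a b Y C l n (fun t => Q t (u t) + f t) u := by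
    intro n
    obtain ⟨u, hu, hd⟩ := linear_ode S.hab
      (L := fun t => ((C t).comp (Y n) + -(l • (1 : X →L[ℂ] X))) + Q t)
      (((S.hC.comp (SCont.const (Y n))).add (SCont.const _).neg).add hQ) hfc z₀
    refine ⟨u, hu, fun t ht => ?_⟩
    convert hd t ht using 1
    simp [sub_eq_add_neg, add_assoc]
  choose zn hzn0 hzn using hex
  obtain ⟨z, hzc, hzlim⟩ := S.conv3 hQ hκ b1 hθκ hfc (x := z₀) (v := zn) (gn := fun _ => f)
    (by simp only [hzn0]; exact tendsto_const_nhds) (tendstoUniformlyOn_const f) hzn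
  set w : ℕ → ℝ → X := fun n t => C t (Y n (zn n t)) - l • zn n t + (Q t (zn n t) + f t) with hw
  have hYw : ∀ n, ∀ t ∈ Icc a b,
      Y n (zn n t) = G t (w n t + l • zn n t - Q t (zn n t) - f t) := by
    intro n t ht
    simp only [hw]
    rw [show C t (Y n (zn n t)) - l • zn n t + (Q t (zn n t) + f t) + l • zn n t - Q t (zn n t)
      - f t = C t (Y n (zn n t)) by abel, S.hGC t ht]
  set H : ℝ → X →L[ℂ] X := fun t => Q' t + ((C' t).comp (G t)).comp (l • (1 : X →L[ℂ] X) + - Q t)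
    with hH
  have hHc : SCont (Icc a b) H := hQ'.add ((S.hC'.comp S.hG).comp ((SCont.const _).add hQ.neg))
  set g₀ : ℝ → X := fun t => f' t - C' t (G t (f t)) with hg₀
  have hg₀c : ContinuousOn g₀ (Icc a b) := hf'.sub (S.hC'.apply (S.hG.apply hfc))
  have hws : ∀ n, IsSol a b Y C l n
      (fun t => (Q t + (C' t).comp (G t)) (w n t) + (H t (zn n t) + g₀ t)) (w n) := by
    intro n t ht
    have h1 : HasDerivWithinAt (zn n) (w n t) (Icc a b) t := hzn n t ht
    have h2 : HasDerivWithinAt (fun τ => Y n (zn n τ)) (Y n (w n t)) (Icc a b) t :=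
      ((Y n).restrictScalars ℝ).hasFDerivAt.comp_hasDerivWithinAt t h1
    have h3 := (((S.hCd.apply S.hC ht h2).fun_sub (h1.fun_const_smul l)).fun_add
      ((hQd.apply hQ ht h1).fun_add (hf t ht)))
    convert h3 using 1
    rw [hYw n t ht]
    simp only [hH, hg₀, add_apply, ContinuousLinearMap.comp_apply,
      neg_apply, smul_apply,
      one_apply_eq_self, map_add, map_sub, map_neg]
    abel
  have hwa : Tendsto (fun n => w n a) atTop (𝓝 (C a (A z₀) - l • z₀ + (Q a z₀ + f a))) := by
    simp only [hw, hzn0]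
    exact ((((C a).continuous.tendsto _).comp (S.hYlim z₀ hz₀)).sub_const _).add_const _
  obtain ⟨q, hqc, hqlim⟩ := S.conv3 (hQ.add (S.hC'.comp S.hG)) hκ b2 hθκ
    ((hHc.apply hzc).add hg₀c) hwa
    (tendstoUniformlyOn_add (hHc.tendstoUniformlyOn hzlim) (tendstoUniformlyOn_const g₀)) hws
  have hder := hasDerivWithinAt_of_uniform S.hab (z := zn) (w := w) (p := z) (q := q)
    hzn (fun t ht => hzlim.tendsto_at ht) hqlim hqc
  have hkey : ∀ t ∈ Icc a b, z t ∈ D ∧ A (z t) = G t (q t + l • z t - Q t (z t) - f t) := by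
    intro t ht
    have t1 := hzlim.tendsto_at ht
    have t2 := hqlim.tendsto_at ht
    have t3 : Tendsto (fun n => Y n (zn n t)) atTop (𝓝 (G t (q t + l • z t - Q t (z t) - f t))) := by
      simp only [hYw _ t ht]
      exact ((G t).continuous.tendsto _).comp
        (((t2.add (t1.const_smul l)).sub (((Q t).continuous.tendsto _).comp t1)).sub_const _)
    have t4 : Tendsto (fun n => J n (zn n t)) atTop (𝓝 (z t)) := by
      have e : ∀ n, J n (zn n t) = zn n t + (1 / ((n:ℝ) + 1)) • Y n (zn n t) := by
        intro n
        have := S.hYJ n (zn n t)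
        rw [sub_eq_iff_eq_add] at this
        nth_rw 2 [this]; abel
      simp only [e]
      have := t1.add ((tendsto_one_div_add_atTop_nhds_zero_nat (𝕜 := ℝ)).smul t3)
      simpa using this
    exact S.md.closed (fun n => S.hJD n _) t4 (by simpa only [S.hAJ] using t3)
  refine ⟨z, q, ?_, fun t ht => (hkey t ht).1, hqc, hder, fun t ht => ?_⟩
  · have := hzlim.tendsto_at ha
    simp only [hzn0] at this
    exact tendsto_nhds_unique this tendsto_const_nhds
  · rw [(hkey t ht).2, S.hCG t ht]; abel

/-- Coefficients on a time set. -/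
structure Coef (s : Set ℝ) (A : X →ₗ[ℂ] X) (D : Submodule ℂ X)
    (C C' G G' Q Q' : ℝ → X →L[ℂ] X) (β : ℝ) : Prop where
  md : MaxDiss A D
  hC : SCont s C
  hCd : SDer s C C'
  hC' : SCont s C'
  hG : SCont s G
  hGd : SDer s G G'
  hG' : SCont s G'
  hQ : SCont s Q
  hQd : SDer s Q Q'
  hQ' : SCont s Q'
  hGC : ∀ t ∈ s, ∀ x, G t (C t x) = x
  hCG : ∀ t ∈ s, ∀ x, C t (G t x) = x
  hsa : ∀ t ∈ s, ∀ x y, ⟪G t x, y⟫ = ⟪x, G t y⟫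
  hβ : 0 < β
  hco : ∀ t ∈ s, ∀ x, β * ‖x‖ ^ 2 ≤ (⟪G t x, x⟫).re

lemma Coef.mono {s s' : Set ℝ} {A : X →ₗ[ℂ] X} {D : Submodule ℂ X}
    {C C' G G' Q Q' : ℝ → X →L[ℂ] X} {β : ℝ} (K : Coef s A D C C' G G' Q Q' β) (h : s' ⊆ s) :
    Coef s' A D C C' G G' Q Q' β :=
  ⟨K.md, K.hC.mono h, K.hCd.mono h, K.hC'.mono h, K.hG.mono h, K.hGd.mono h, K.hG'.mono h,
    K.hQ.mono h, K.hQd.mono h, K.hQ'.mono h, fun t ht => K.hGC t (h ht), fun t ht => K.hCG t (h ht),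
    fun t ht => K.hsa t (h ht), K.hβ, fun t ht => K.hco t (h ht)⟩

set_option maxHeartbeats 1000000 in
lemma Coef.exists_Icc [CompleteSpace X] {a b : ℝ} {A : X →ₗ[ℂ] X} {D : Submodule ℂ X}
    {C C' G G' Q Q' : ℝ → X →L[ℂ] X} {β : ℝ} (K : Coef (Icc a b) A D C C' G G' Q Q' β)
    (hab : a ≤ b) {f f' : ℝ → X}
    (hf : ∀ t ∈ Icc a b, HasDerivWithinAt f (f' t) (Icc a b) t)
    (hf' : ContinuousOn f' (Icc a b)) {z₀ : X} (hz₀ : z₀ ∈ D) :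
    ∃ z : ℝ → X, z a = z₀ ∧ (∀ t ∈ Icc a b, z t ∈ D) ∧
      (∀ t ∈ Icc a b, HasDerivWithinAt z (C t (A (z t)) + Q t (z t) + f t) (Icc a b) t) ∧
      ContinuousOn (fun t => C t (A (z t)) + Q t (z t) + f t) (Icc a b) := by
  have hβ := K.hβ
  have hfc : ContinuousOn f (Icc a b) := fun t ht => (hf t ht).continuousWithinAt
  obtain ⟨J, Y, h1, h2, h3, h4, h5⟩ := K.md.exists_yosida
  obtain ⟨c₁, hc₁, d₁⟩ := K.hC'.1 b
  obtain ⟨c₂, hc₂, d₂⟩ := K.hG.1 b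
  obtain ⟨c₃, hc₃, d₃⟩ := K.hG'.1 b
  obtain ⟨c₄, hc₄, d₄⟩ := K.hQ.1 b
  set γ := c₁ + c₂ + c₃ + 1 with hγ
  have hγ0 : 0 < γ := by positivity
  set κ := c₄ + c₁ * c₂ with hκ
  have hκ0 : 0 ≤ κ := by positivity
  set m := 2 * γ * (γ ^ 2 + κ) with hm
  have hm0 : 0 < m := by positivity
  set l := (γ + 1 + m ^ 2) / β with hl
  have hlβ : l * β = γ + 1 + m ^ 2 := by rw [hl]; field_simp
  have hsq : m ≤ √(l * β) := by
    apply Real.le_sqrt_of_sq_le; rw [hlβ]; linarith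
  have hθ : ∀ k, 0 ≤ k → k ≤ γ ^ 2 + κ → γ / √(l * β) * k ≤ 1 / 2 := by
    intro k hk0 hk
    rw [div_mul_eq_mul_div, div_le_iff₀ (hm0.trans_le hsq)]
    have : γ * k ≤ γ * (γ ^ 2 + κ) := by gcongr
    linarith
  have S : Sys a b A D J Y C C' G G' β γ l :=
    { hab := hab, md := K.md, hJD := h1, hAJ := h2, hYJ := h3, hYd := h4, hYlim := h5,
      hC := K.hC, hCd := K.hCd, hC' := K.hC', hG := K.hG, hGd := K.hGd, hGC := K.hGC,
      hCG := K.hCG, hsa := K.hsa, hβ := hβ, hco := K.hco, hγ := hγ0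
      bC' := fun t ht => (d₁ t ht ht.2).trans (by linarith)
      bG := fun t ht => (d₂ t ht ht.2).trans (by linarith)
      bG' := fun t ht => (d₃ t ht ht.2).trans (by linarith)
      hl := by rw [hlβ]; nlinarith
      hθ := hθ _ (by positivity) (by linarith) }
  have hexp : ∀ c t : ℝ, HasDerivWithinAt (fun t => Real.exp (c * t)) (Real.exp (c * t) * c)
      (Icc a b) t := fun c t => by
    simpa using (((hasDerivAt_id t).const_mul c).exp).hasDerivWithinAt
  have hexpc : ∀ c : ℝ, ContinuousOn (fun t => Real.exp (c * t)) (Icc a b) := fun c =>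
    (by fun_prop : Continuous fun t => Real.exp (c * t)).continuousOn
  obtain ⟨z, q, hza, hzD, hqc, hzd, hq⟩ := S.exists_core (Q := Q) (Q' := Q') (κ := κ) K.hQ K.hQd
    K.hQ' hκ0 (fun t ht => (d₄ t ht ht.2).trans (by nlinarith))
    (fun t ht => (norm_add_le _ _).trans (add_le_add (d₄ t ht ht.2)
      ((ContinuousLinearMap.opNorm_comp_le _ _).trans (by
        gcongr
        · exact d₁ t ht ht.2
        · exact d₂ t ht ht.2)))) (hθ κ hκ0 (by nlinarith [sq_nonneg γ]))
    (f := fun t => Real.exp (-l * t) • f t)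
    (fun t ht => (hexp (-l) t).fun_smul (hf t ht))
    (((hexpc (-l)).smul hf').add (((hexpc (-l)).mul continuousOn_const).smul hfc))
    (z₀ := Real.exp (-l * a) • z₀) (D.smul_of_tower_mem _ hz₀)
  have hcancel : ∀ t : ℝ, Real.exp (l * t) * Real.exp (-l * t) = 1 := fun t => by
    rw [← Real.exp_add]; simp
  have hval : ∀ t ∈ Icc a b, C t (A (Real.exp (l * t) • z t)) + Q t (Real.exp (l * t) • z t) + f t
      = Real.exp (l * t) • q t + (Real.exp (l * t) * l) • z t := by
    intro t ht
    rw [hq t ht]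
    rw [LinearMap.map_smul_of_tower, ContinuousLinearMap.map_smul_of_tower,
      ContinuousLinearMap.map_smul_of_tower]
    simp only [smul_add, smul_sub, smul_smul, hcancel, one_smul]
    abel
  refine ⟨fun t => Real.exp (l * t) • z t, ?_, fun t ht => D.smul_of_tower_mem _ (hzD t ht),
    fun t ht => ?_, ?_⟩
  · simp only [hza, smul_smul, hcancel, one_smul]
  · beta_reduce
    rw [hval t ht]
    exact (hexp l t).fun_smul (hzd t ht)
  · refine ContinuousOn.congr ?_ hval
    have hzc : ContinuousOn z (Icc a b) := fun t ht => (hzd t ht).continuousWithinAt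
    exact ((hexpc l).smul hqc).add (((hexpc l).mul continuousOn_const).smul hzc)


/-- The operator `C(t)A + Q(t)`. -/
def Bop (A : X →ₗ[ℂ] X) (C Q : ℝ → X →L[ℂ] X) (t : ℝ) : X →ₗ[ℂ] X :=
  (C t : X →ₗ[ℂ] X) ∘ₗ A + (Q t : X →ₗ[ℂ] X)

lemma Bop_apply (A : X →ₗ[ℂ] X) (C Q : ℝ → X →L[ℂ] X) (t : ℝ) (x : X) :
    Bop A C Q t x = C t (A x) + Q t x := rfl

section Zpic

variable {A : X →ₗ[ℂ] X} {D : Submodule ℂ X} {C C' G G' Q Q' : ℝ → X →L[ℂ] X} {β : ℝ}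

/-- Energy estimate for classical solutions. -/
lemma Coef.est {T : ℝ} (hT : 0 ≤ T) (K : Coef (Icc 0 T) A D C C' G G' Q Q' β) :
    ∃ L : ℝ, 0 ≤ L ∧ ∀ a b : ℝ, 0 ≤ a → a ≤ b → b ≤ T → ∀ (z f : ℝ → X) (η : ℝ), 0 ≤ η →
      ContinuousOn z (Icc a b) → (∀ t ∈ Ioo a b, z t ∈ D) →
      (∀ t ∈ Ioo a b, HasDerivAt z (Bop A C Q t (z t) + f t) t) →
      (∀ t ∈ Ioo a b, ‖f t‖ ≤ η) →
      ∀ t ∈ Icc a b, ‖z t‖ ^ 2 ≤ L * (‖z a‖ ^ 2 + η ^ 2 * (t - a)) := by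
  have hβ := K.hβ
  obtain ⟨cG, hcG, dG⟩ := K.hG.1 T
  obtain ⟨cG', hcG', dG'⟩ := K.hG'.1 T
  obtain ⟨cQ, hcQ, dQ⟩ := K.hQ.1 T
  set l₀ := (cG' + 1) / β with hl₀
  have hl₀β : l₀ * β = cG' + 1 := by rw [hl₀]; field_simp
  set l := l₀ + cG * cQ / β with hl
  have hl0 : 0 ≤ l := by positivity
  refine ⟨Real.exp (l * T) ^ 2 * (cG + cG ^ 2) / β, by positivity, ?_⟩
  intro a b ha hab hbT z f η hη hzc hzD hzd hf t ht
  have hsub : Icc a b ⊆ Icc 0 T := Icc_subset_Icc ha hbT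
  have hexp : ∀ t : ℝ, HasDerivAt (fun t => Real.exp (-l * (t - a))) (Real.exp (-l * (t - a)) * (-l))
      t := fun t => by
    simpa using ((((hasDerivAt_id t).sub_const a).const_mul (-l)).exp)
  set u : ℝ → X := fun t => Real.exp (-l * (t - a)) • z t with hu
  have huc : ContinuousOn u (Icc a b) :=
    (by fun_prop : Continuous fun t => Real.exp (-l * (t - a))).continuousOn.smul hzc
  have h1 := (energy (K.hG.mono hsub) (K.hGd.mono hsub) hβ hcG' (fun t ht => K.hco t (hsub ht))
    (fun t ht => dG' t (hsub ht) (hsub ht).2) (fun t ht => K.hsa t (hsub ht)) hl₀β.ge huc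
    (u' := fun t => Real.exp (-l * (t - a)) • (Bop A C Q t (z t) + f t) +
      (Real.exp (-l * (t - a)) * (-l)) • z t)
    (fun t ht => (hexp t).smul (hzd t ht)) (η := cG * η) (ρ := 0) le_rfl (by
      intro t ht
      have ht' := hsub (Ioo_subset_Icc_self ht)
      set e := Real.exp (-l * (t - a)) with he
      have he0 : 0 < e := Real.exp_pos _
      have he1 : e ≤ 1 := by
        rw [he, Real.exp_le_one_iff]
        nlinarith [ht.1]
      have hut : u t = e • z t := rfl
      have e1 : e • (Bop A C Q t (z t) + f t) + (e * (-l)) • z t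
          = C t (A (u t)) + Q t (u t) + e • f t - l • u t := by
        rw [hut, LinearMap.map_smul_of_tower, ContinuousLinearMap.map_smul_of_tower,
          ContinuousLinearMap.map_smul_of_tower, Bop_apply, smul_add, smul_add, smul_smul,
          mul_neg, neg_smul, mul_comm l e]
        abel
      rw [e1, map_sub, map_add, map_add, K.hGC t ht', (G t).map_smul_of_tower e (f t),
        (G t).map_smul_of_tower l (u t), inner_sub_left, inner_add_left, inner_add_left,
        Complex.sub_re, Complex.add_re, Complex.add_re, re_inner_real_smul_left l]
      have q1 := K.md.diss (u t) (D.smul_of_tower_mem e (hzD t ht))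
      have q2 : (⟪G t (Q t (u t)), u t⟫).re ≤ cG * cQ * ‖u t‖ ^ 2 := by
        refine (re_inner_le _ _).trans ?_
        have := (G t).le_of_opNorm_le_of_le (dG t ht' ht'.2)
          ((Q t).le_of_opNorm_le (dQ t ht' ht'.2) (u t))
        nlinarith [norm_nonneg (u t)]
      have q3 : (⟪e • G t (f t), u t⟫).re ≤ cG * η * ‖u t‖ := by
        refine (re_inner_le _ _).trans ?_
        rw [norm_smul, Real.norm_eq_abs, abs_of_pos he0]
        have := (G t).le_of_opNorm_le_of_le (dG t ht' ht'.2) (hf t ht)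
        have h5 : e * ‖G t (f t)‖ ≤ 1 * (cG * η) := by gcongr
        rw [one_mul] at h5
        gcongr
      have q4 := K.hco t ht' (u t)
      have q5 : cG * cQ * ‖u t‖ ^ 2 ≤ cG * cQ / β * (⟪G t (u t), u t⟫).re := by
        calc cG * cQ * ‖u t‖ ^ 2 = cG * cQ / β * (β * ‖u t‖ ^ 2) := by field_simp
          _ ≤ _ := by gcongr
      have q6 : l * (⟪G t (u t), u t⟫).re = l₀ * (⟪G t (u t), u t⟫).re +
        cG * cQ / β * (⟪G t (u t), u t⟫).re := by rw [hl]; ring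
      linarith) t ht).2
  have haT : a ∈ Icc 0 T := hsub ⟨le_rfl, hab⟩
  have hua : u a = z a := by simp [hu]
  rw [hua] at h1
  have h2 : (⟪G a (z a), z a⟫).re ≤ cG * ‖z a‖ ^ 2 := by
    refine (re_inner_le _ _).trans ?_
    have := (G a).le_of_opNorm_le (dG a haT haT.2) (z a)
    nlinarith [norm_nonneg (z a)]
  have h3 := K.hco t (hsub ht) (u t)
  have hta : 0 ≤ t - a := sub_nonneg.2 ht.1
  have h4 : β * ‖u t‖ ^ 2 ≤ (cG + cG ^ 2) * (‖z a‖ ^ 2 + η ^ 2 * (t - a)) := by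
    have e1 : 0 ≤ cG * (η ^ 2 * (t - a)) := by positivity
    have e2 : 0 ≤ cG ^ 2 * ‖z a‖ ^ 2 := by positivity
    nlinarith
  have h5 : z t = Real.exp (l * (t - a)) • u t := by
    simp only [hu, smul_smul]
    rw [← Real.exp_add]; simp
  rw [h5, norm_smul, Real.norm_eq_abs, Real.abs_exp, mul_pow]
  have h6 : Real.exp (l * (t - a)) ≤ Real.exp (l * T) := by
    apply Real.exp_le_exp.2
    have := (hsub ht).2
    gcongr
    linarith
  have h7 : ‖u t‖ ^ 2 ≤ (cG + cG ^ 2) * (‖z a‖ ^ 2 + η ^ 2 * (t - a)) / β := by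
    rw [le_div_iff₀ hβ]; linarith
  calc _ ≤ Real.exp (l * T) ^ 2 * ((cG + cG ^ 2) * (‖z a‖ ^ 2 + η ^ 2 * (t - a)) / β) := by
        gcongr
    _ = _ := by ring

open NBCS

lemma sol_mono {s r : ℝ} (hsr : s ≤ r) {B : ℝ → X →ₗ[ℂ] X} {f z : ℝ → X} {zs : X}
    (h : IsClassicalSolution B (fun _ => D) f s zs z) :
    IsClassicalSolution B (fun _ => D) f r (z r) z :=
  ⟨h.1.mono (Ici_subset_Ici.2 hsr), rfl, fun t ht => h.2.2.1 t (hsr.trans ht),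
    fun t ht => h.2.2.2.1 t (hsr.trans_lt ht), h.2.2.2.2.mono (Ioi_subset_Ioi hsr)⟩

lemma sol_of_C1 {s : ℝ} {B : ℝ → X →ₗ[ℂ] X} {dom : ℝ → Submodule ℂ X} {f z : ℝ → X} {zs : X}
    (h : IsClassicalSolutionC1 B dom f s zs z) :
    IsClassicalSolution B dom f s zs z :=
  ⟨fun t ht => (h.2.2.1 t ht).continuousWithinAt, h.1, h.2.1,
    fun t ht => (h.2.2.1 t ht.le).hasDerivAt (Ici_mem_nhds ht), h.2.2.2.mono Ioi_subset_Ici_self⟩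

lemma sol_congr {s : ℝ} {B : ℝ → X →ₗ[ℂ] X} {dom : ℝ → Submodule ℂ X} {f z z' : ℝ → X} {zs : X}
    (h : IsClassicalSolution B dom f s zs z) (he : ∀ t, s ≤ t → z' t = z t) :
    IsClassicalSolution B dom f s zs z' := by
  refine ⟨h.1.congr he, (he s le_rfl).trans h.2.1, fun t ht => ?_, fun t ht => ?_, ?_⟩
  · rw [he t ht]; exact h.2.2.1 t ht
  · rw [he t ht.le]
    refine (h.2.2.2.1 t ht).congr_of_eventuallyEq ?_
    filter_upwards [Ici_mem_nhds ht] with r hr using he r hr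
  · refine h.2.2.2.2.congr fun t ht => ?_
    beta_reduce
    rw [he t (le_of_lt ht)]

/-- Uniqueness of classical solutions. -/
lemma sol_unique (HK : ∀ T, 0 ≤ T → ∃ β, Coef (Icc 0 T) A D C C' G G' Q Q' β)
    {s : ℝ} (hs : 0 ≤ s) {f z₁ z₂ : ℝ → X} {zs : X}
    (h₁ : IsClassicalSolution (Bop A C Q) (fun _ => D) f s zs z₁)
    (h₂ : IsClassicalSolution (Bop A C Q) (fun _ => D) f s zs z₂) :
    ∀ t, s ≤ t → z₁ t = z₂ t := by
  intro t ht
  obtain ⟨β, K⟩ := HK t (hs.trans ht)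
  obtain ⟨L, hL, hest⟩ := K.est (hs.trans ht)
  have h := hest s t hs ht le_rfl (fun t => z₁ t - z₂ t) (fun _ => 0) 0 le_rfl
    ((h₁.1.sub h₂.1).mono Icc_subset_Ici_self)
    (fun r hr => D.sub_mem (h₁.2.2.1 r hr.1.le) (h₂.2.2.1 r hr.1.le))
    (fun r hr => by
      convert (h₁.2.2.2.1 r hr.1).fun_sub (h₂.2.2.2.1 r hr.1) using 1
      rw [map_sub]; abel) (fun r _ => by simp) t ⟨ht, le_rfl⟩
  simp only [h₁.2.1, h₂.2.1, sub_self, norm_zero] at h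
  have h' : ‖z₁ t - z₂ t‖ ^ 2 ≤ 0 := by linarith
  exact sub_eq_zero.1 (norm_eq_zero.1 (pow_eq_zero_iff (two_ne_zero) |>.1
    (le_antisymm h' (by positivity))))

/-- Global existence. -/
lemma sol_exists [CompleteSpace X] (HK : ∀ T, 0 ≤ T → ∃ β, Coef (Icc 0 T) A D C C' G G' Q Q' β)
    {s : ℝ} (hs : 0 ≤ s) {f f' : ℝ → X}
    (hf : ∀ t ∈ Ici (0:ℝ), HasDerivWithinAt f (f' t) (Ici 0) t)
    (hf' : ContinuousOn f' (Ici 0)) {zs : X} (hzs : zs ∈ D) :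
    ∃ z, IsClassicalSolutionC1 (Bop A C Q) (fun _ => D) f s zs z := by
  have hex : ∀ n : ℕ, ∃ z : ℝ → X, z s = zs ∧ (∀ t ∈ Icc s (s + n), z t ∈ D) ∧
      (∀ t ∈ Icc s (s + n), HasDerivWithinAt z (C t (A (z t)) + Q t (z t) + f t)
        (Icc s (s + n)) t) ∧
      ContinuousOn (fun t => C t (A (z t)) + Q t (z t) + f t) (Icc s (s + n)) := by
    intro n
    have hn : s ≤ s + n := by simp
    obtain ⟨β, K⟩ := HK (s + n) (hs.trans hn)
    have hsub : Icc s (s + n) ⊆ Ici 0 := fun t ht => hs.trans ht.1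
    exact (K.mono (Icc_subset_Icc hs le_rfl)).exists_Icc hn
      (fun t ht => (hf t (hsub ht)).mono hsub) (hf'.mono hsub) hzs
  choose z hz0 hzD hzd hzc using hex
  have hagree : ∀ n m : ℕ, n ≤ m → ∀ t ∈ Icc s (s + n), z n t = z m t := by
    intro n m hnm t ht
    have hnm' : (n:ℝ) ≤ m := by exact_mod_cast hnm
    have hsub : Icc s (s + n) ⊆ Icc s (s + m) := Icc_subset_Icc le_rfl (by linarith)
    have hn : s ≤ s + n := by simp
    obtain ⟨β, K⟩ := HK (s + n) (hs.trans hn)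
    obtain ⟨L, hL, hest⟩ := K.est (hs.trans hn)
    have h := hest s (s + n) hs hn le_rfl (fun t => z n t - z m t) (fun _ => 0) 0 le_rfl
      (ContinuousOn.sub (fun r hr => (hzd n r hr).continuousWithinAt)
        (fun r hr => (hzd m r (hsub hr)).continuousWithinAt.mono hsub))
      (fun r hr => D.sub_mem (hzD n r (Ioo_subset_Icc_self hr))
        (hzD m r (hsub (Ioo_subset_Icc_self hr))))
      (fun r hr => by
        have k1 := (hzd n r (Ioo_subset_Icc_self hr)).hasDerivAt (Icc_mem_nhds hr.1 hr.2)
        have k2 := (hzd m r (hsub (Ioo_subset_Icc_self hr))).hasDerivAt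
          (Icc_mem_nhds hr.1 (by linarith [hr.2]))
        convert k1.fun_sub k2 using 1
        rw [map_sub, Bop_apply, Bop_apply]; abel) (fun r _ => by simp) t ht
    simp only [hz0, sub_self, norm_zero] at h
    have h' : ‖z n t - z m t‖ ^ 2 ≤ 0 := by linarith
    exact sub_eq_zero.1 (norm_eq_zero.1 (pow_eq_zero_iff (two_ne_zero) |>.1
      (le_antisymm h' (by positivity))))
  set w : ℝ → X := fun t => z ⌈t - s⌉₊ t with hw
  have hwz : ∀ n : ℕ, ∀ t ∈ Icc s (s + n), w t = z n t := by
    intro n t ht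
    refine hagree _ _ ?_ t ⟨ht.1, ?_⟩
    · exact Nat.ceil_le.2 (by linarith [ht.2])
    · linarith [Nat.le_ceil (t - s)]
  have hnb : ∀ t, s ≤ t → ∃ n : ℕ, t ∈ Icc s (s + n) ∧ Icc s (s + n) ∈ 𝓝[Ici s] t := by
    intro t ht
    obtain ⟨n, hn⟩ := exists_nat_gt (t - s)
    refine ⟨n, ⟨ht, by linarith⟩, ?_⟩
    rw [← Ici_inter_Iic]
    exact inter_mem self_mem_nhdsWithin (mem_nhdsWithin_of_mem_nhds (Iic_mem_nhds (by linarith)))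
  refine ⟨w, ?_, fun t ht => ?_, fun t ht => ?_, fun t ht => ?_⟩
  · rw [hwz 0 s (by simp)]; exact hz0 0
  · obtain ⟨n, htn, -⟩ := hnb t ht
    rw [hwz n t htn]; exact hzD n t htn
  · obtain ⟨n, htn, hmem⟩ := hnb t ht
    rw [hwz n t htn, Bop_apply]
    refine ((hzd n t htn).mono_of_mem_nhdsWithin hmem).congr_of_eventuallyEq ?_ (hwz n t htn)
    filter_upwards [hmem] with r hr using hwz n r hr
  · obtain ⟨n, htn, hmem⟩ := hnb t ht
    refine ((hzc n t htn).mono_of_mem_nhdsWithin hmem).congr_of_eventuallyEq ?_ ?_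
    · filter_upwards [hmem] with r hr
      rw [hwz n r hr, Bop_apply]
    · rw [hwz n t htn, Bop_apply]

end Zpic


section Evol

open NBCS

lemma tendsto_dense {α : Type*} {l : Filter α} {D : Submodule ℂ X} (hD : Dense (D : Set X))
    {K : α → X →L[ℂ] X} {k : X →L[ℂ] X} {c : ℝ} (hc : ∀ᶠ q in l, ‖K q‖ ≤ c)
    (h : ∀ x ∈ D, Tendsto (fun q => K q x) l (𝓝 (k x))) {u : α → X} {y : X}
    (hu : Tendsto u l (𝓝 y)) : Tendsto (fun q => K q (u q)) l (𝓝 (k y)) := by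
  set c' := max c ‖k‖ + 1 with hc'
  have hc'0 : 0 < c' := by have := norm_nonneg k; have := le_max_right c ‖k‖; linarith
  have hcc : c ≤ c' := by have := le_max_left c ‖k‖; linarith
  have hkc : ‖k‖ ≤ c' := by have := le_max_right c ‖k‖; linarith
  rw [Metric.tendsto_nhds]
  intro ε hε
  obtain ⟨d, hd, hdy⟩ := Metric.dense_iff.1 hD y (ε / (4 * c')) (by positivity)
  have hdy' : ‖y - d‖ < ε / (4 * c') := by
    rw [Metric.mem_ball, dist_comm, dist_eq_norm] at hd; exact hd
  have h1 := Metric.tendsto_nhds.1 hu (ε / (4 * c')) (by positivity)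
  have h2 := Metric.tendsto_nhds.1 (h d hdy) (ε / 4) (by positivity)
  filter_upwards [hc, h1, h2] with q q1 q2 q3
  rw [dist_eq_norm] at q2 q3 ⊢
  have e : K q (u q) - k y = K q (u q - y) + K q (y - d) + (K q d - k d) - k (y - d) := by
    simp only [map_sub]; abel
  have b1 : ‖K q (u q - y)‖ ≤ c' * (ε / (4 * c')) :=
    ((K q).le_opNorm _).trans (by gcongr; exact q1.trans hcc)
  have b2 : ‖K q (y - d)‖ ≤ c' * (ε / (4 * c')) :=
    ((K q).le_opNorm _).trans (by gcongr; exact q1.trans hcc)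
  have b3 : ‖k (y - d)‖ ≤ c' * (ε / (4 * c')) :=
    (k.le_opNorm _).trans (by gcongr)
  have e4 : c' * (ε / (4 * c')) = ε / 4 := by field_simp
  rw [e4] at b1 b2 b3
  rw [e]
  have t1 := norm_sub_le (K q (u q - y) + K q (y - d) + (K q d - k d)) (k (y - d))
  have t2 := norm_add₃_le (a := K q (u q - y)) (b := K q (y - d)) (c := (K q d - k d))
  linarith

lemma ext_dense {D : Submodule ℂ X} (hD : Dense (D : Set X)) {K L : X →L[ℂ] X}
    (h : ∀ x ∈ D, K x = L x) : K = L := by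
  have := Continuous.ext_on hD K.continuous L.continuous h
  ext x; exact congrFun this x

variable {A : X →ₗ[ℂ] X} {D : Submodule ℂ X} {C C' G G' Q Q' : ℝ → X →L[ℂ] X}

lemma solC1_congr {s : ℝ} {B : ℝ → X →ₗ[ℂ] X} {dom : ℝ → Submodule ℂ X} {f z z' : ℝ → X} {zs : X}
    (h : IsClassicalSolutionC1 B dom f s zs z) (he : ∀ t, s ≤ t → z' t = z t) :
    IsClassicalSolutionC1 B dom f s zs z' := by
  refine ⟨(he s le_rfl).trans h.1, fun t ht => ?_, fun t ht => ?_, ?_⟩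
  · rw [he t ht]; exact h.2.1 t ht
  · rw [he t ht]
    exact (h.2.2.1 t ht).congr he (he t ht)
  · refine h.2.2.2.congr fun t ht => ?_
    beta_reduce
    rw [he t ht]

lemma sol_add {s : ℝ} {B : ℝ → X →ₗ[ℂ] X} {f₁ f₂ z₁ z₂ : ℝ → X} {x₁ x₂ : X}
    (h₁ : IsClassicalSolution B (fun _ => D) f₁ s x₁ z₁)
    (h₂ : IsClassicalSolution B (fun _ => D) f₂ s x₂ z₂) :
    IsClassicalSolution B (fun _ => D) (fun t => f₁ t + f₂ t) s (x₁ + x₂)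
      (fun t => z₁ t + z₂ t) := by
  have e : ∀ t, B t (z₁ t + z₂ t) + (f₁ t + f₂ t) = (B t (z₁ t) + f₁ t) + (B t (z₂ t) + f₂ t) := by
    intro t; rw [map_add]; abel
  refine ⟨h₁.1.add h₂.1, by simp only [h₁.2.1, h₂.2.1],
    fun t ht => D.add_mem (h₁.2.2.1 t ht) (h₂.2.2.1 t ht), fun t ht => ?_, ?_⟩
  · rw [e]; exact (h₁.2.2.2.1 t ht).fun_add (h₂.2.2.2.1 t ht)
  · simp only [e]; exact h₁.2.2.2.2.add h₂.2.2.2.2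

lemma sol_smul {s : ℝ} {B : ℝ → X →ₗ[ℂ] X} {f z : ℝ → X} {x : X} (c : ℂ)
    (h : IsClassicalSolution B (fun _ => D) f s x z) :
    IsClassicalSolution B (fun _ => D) (fun t => c • f t) s (c • x) (fun t => c • z t) := by
  have e : ∀ t, B t (c • z t) + c • f t = c • (B t (z t) + f t) := by
    intro t; rw [map_smul, smul_add]
  refine ⟨h.1.const_smul c, by simp only [h.2.1],
    fun t ht => D.smul_mem c (h.2.2.1 t ht), fun t ht => ?_, ?_⟩
  · rw [e]; exact (h.2.2.2.1 t ht).fun_const_smul c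
  · simp only [e]; exact h.2.2.2.2.const_smul c

/-- bound for homogeneous solutions -/
lemma hom_bound (HK : ∀ T, 0 ≤ T → ∃ β, Coef (Icc 0 T) A D C C' G G' Q Q' β) {T : ℝ} (hT : 0 ≤ T) :
    ∃ L : ℝ, 0 ≤ L ∧ ∀ s t, 0 ≤ s → s ≤ t → t ≤ T → ∀ x z,
      IsClassicalSolution (Bop A C Q) (fun _ => D) (fun _ => 0) s x z → ‖z t‖ ≤ L * ‖x‖ := by
  obtain ⟨β, K⟩ := HK T hT
  obtain ⟨L, hL, hest⟩ := K.est hT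
  refine ⟨√L, by positivity, fun s t hs hst htT x z hz => ?_⟩
  have h := hest s t hs hst htT z (fun _ => 0) 0 le_rfl
    (hz.1.mono Icc_subset_Ici_self) (fun r hr => hz.2.2.1 r hr.1.le)
    (fun r hr => hz.2.2.2.1 r hr.1) (by simp) t ⟨hst, le_rfl⟩
  rw [hz.2.1] at h
  refine le_of_sq_le_sq ?_ (by positivity)
  rw [mul_pow, Real.sq_sqrt hL]
  simpa using h

lemma exists_V [CompleteSpace X] (HK : ∀ T, 0 ≤ T → ∃ β, Coef (Icc 0 T) A D C C' G G' Q Q' β) :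
    ∃ V : ℝ → ℝ → X →L[ℂ] X, ∀ s, 0 ≤ s → ∀ x ∈ D,
      IsClassicalSolutionC1 (Bop A C Q) (fun _ => D) (fun _ => 0) s x (fun t => V t s x) := by
  have hD : Dense (D : Set X) := by
    obtain ⟨β, K⟩ := HK 0 le_rfl
    exact K.md.dense
  have key : ∀ s, 0 ≤ s → ∃ Vs : ℝ → X →L[ℂ] X, ∀ x ∈ D,
      IsClassicalSolutionC1 (Bop A C Q) (fun _ => D) (fun _ => 0) s x (fun t => Vs t x) := by
    intro s hs
    have hex : ∀ x, x ∈ D → ∃ z, IsClassicalSolutionC1 (Bop A C Q) (fun _ => D) (fun _ => 0) s x z :=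
      fun x hx => sol_exists HK hs (f := fun _ => 0) (f' := fun _ => 0)
        (fun t _ => hasDerivWithinAt_const _ _ _) continuousOn_const hx
    choose! z hz using hex
    have hV : ∀ t, s ≤ t → ∃ v : X →L[ℂ] X, ∀ x ∈ D, v x = z x t := by
      intro t ht
      let f : D →ₗ[ℂ] X :=
        { toFun := fun x => z x t
          map_add' := fun x y => by
            have h := sol_add (sol_of_C1 (hz x x.2)) (sol_of_C1 (hz y y.2))
            simp only [add_zero] at h
            exact sol_unique HK hs (sol_of_C1 (hz _ (D.add_mem x.2 y.2))) h t ht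
          map_smul' := fun c x => by
            have h := sol_smul c (sol_of_C1 (hz x x.2))
            simp only [smul_zero] at h
            exact sol_unique HK hs (sol_of_C1 (hz _ (D.smul_mem c x.2))) h t ht }
      obtain ⟨L, hL, hb⟩ := hom_bound HK (hs.trans ht)
      refine ⟨f.extendOfNorm D.subtype, fun x hx => ?_⟩
      have := LinearMap.extendOfNorm_eq (f := f) (e := D.subtype)
        (by simpa [DenseRange] using hD)
        ⟨L, fun x => hb s t hs ht le_rfl x _ (sol_of_C1 (hz x x.2))⟩ ⟨x, hx⟩
      simpa [f] using this
    choose! v hv using hV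
    exact ⟨v, fun x hx => solC1_congr (hz x hx) fun t ht => hv t ht x hx⟩
  choose! V hV using key
  exact ⟨fun t s => V s t, hV⟩

variable {V : ℝ → ℝ → X →L[ℂ] X}

lemma V_bound (HK : ∀ T, 0 ≤ T → ∃ β, Coef (Icc 0 T) A D C C' G G' Q Q' β)
    (hD : Dense (D : Set X)) (hV : ∀ s, 0 ≤ s → ∀ x ∈ D,
      IsClassicalSolutionC1 (Bop A C Q) (fun _ => D) (fun _ => 0) s x (fun t => V t s x))
    {T : ℝ} (hT : 0 ≤ T) :
    ∃ L : ℝ, 0 ≤ L ∧ ∀ s t, 0 ≤ s → s ≤ t → t ≤ T → ‖V t s‖ ≤ L := by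
  obtain ⟨L, hL, hb⟩ := hom_bound HK hT
  refine ⟨L, hL, fun s t hs hst htT => ContinuousLinearMap.opNorm_le_bound _ hL fun x => ?_⟩
  have hcl : IsClosed {x : X | ‖V t s x‖ ≤ L * ‖x‖} :=
    isClosed_le (by fun_prop) (by fun_prop)
  have : closure (D : Set X) ⊆ {x : X | ‖V t s x‖ ≤ L * ‖x‖} :=
    closure_minimal (fun x hx => hb s t hs hst htT x _ (sol_of_C1 (hV s hs x hx))) hcl
  exact this (hD x)

lemma V_self (hD : Dense (D : Set X)) (hV : ∀ s, 0 ≤ s → ∀ x ∈ D,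
      IsClassicalSolutionC1 (Bop A C Q) (fun _ => D) (fun _ => 0) s x (fun t => V t s x))
    {s : ℝ} (hs : 0 ≤ s) : V s s = 1 :=
  ext_dense hD fun x hx => (hV s hs x hx).1

lemma V_comp (HK : ∀ T, 0 ≤ T → ∃ β, Coef (Icc 0 T) A D C C' G G' Q Q' β)
    (hD : Dense (D : Set X)) (hV : ∀ s, 0 ≤ s → ∀ x ∈ D,
      IsClassicalSolutionC1 (Bop A C Q) (fun _ => D) (fun _ => 0) s x (fun t => V t s x))
    {s r t : ℝ} (hs : 0 ≤ s) (hsr : s ≤ r) (hrt : r ≤ t) : V t s = (V t r).comp (V r s) :=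
  ext_dense hD fun x hx => by
    have h1 := sol_mono hsr (sol_of_C1 (hV s hs x hx))
    have h2 := sol_of_C1 (hV r (hs.trans hsr) (V r s x) ((hV s hs x hx).2.1 r hsr))
    exact sol_unique HK (hs.trans hsr) h1 h2 t hrt

lemma V_small (HK : ∀ T, 0 ≤ T → ∃ β, Coef (Icc 0 T) A D C C' G G' Q Q' β)
    (hV : ∀ s, 0 ≤ s → ∀ x ∈ D,
      IsClassicalSolutionC1 (Bop A C Q) (fun _ => D) (fun _ => 0) s x (fun t => V t s x))
    {T : ℝ} (hT : 0 ≤ T) {x : X} (hx : x ∈ D) :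
    ∃ c : ℝ, 0 ≤ c ∧ ∀ s t, 0 ≤ s → s ≤ t → t ≤ T → ‖V t s x - x‖ ≤ √(c * (t - s)) := by
  obtain ⟨β, K⟩ := HK T hT
  obtain ⟨L, hL, hest⟩ := K.est hT
  obtain ⟨cC, hcC, dC⟩ := K.hC.1 T
  obtain ⟨cQ, hcQ, dQ⟩ := K.hQ.1 T
  set η := cC * ‖A x‖ + cQ * ‖x‖ with hη
  have hη0 : 0 ≤ η := by positivity
  refine ⟨L * η ^ 2, by positivity, fun s t hs hst htT => ?_⟩
  have hz := sol_of_C1 (hV s hs x hx)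
  have h := hest s t hs hst htT (fun t => V t s x - x) (fun t => Bop A C Q t x) η hη0
    ((hz.1.mono Icc_subset_Ici_self).sub continuousOn_const)
    (fun r hr => D.sub_mem (hz.2.2.1 r hr.1.le) hx)
    (fun r hr => by
      convert (hz.2.2.2.1 r hr.1).sub_const x using 1
      rw [map_sub]; simp)
    (fun r hr => by
      have hr' : r ∈ Icc 0 T := ⟨hs.trans hr.1.le, hr.2.le.trans htT⟩
      rw [Bop_apply]
      refine (norm_add_le _ _).trans (add_le_add ?_ ?_)
      · exact ((C r).le_opNorm _).trans (by gcongr; exact dC r hr' hr'.2)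
      · exact ((Q r).le_opNorm _).trans (by gcongr; exact dQ r hr' hr'.2))
    t ⟨hst, le_rfl⟩
  refine Real.le_sqrt_of_sq_le (h.trans_eq ?_)
  have : V s s x = x := hz.2.1
  simp only [this, sub_self, norm_zero]
  ring

lemma V_cont (HK : ∀ T, 0 ≤ T → ∃ β, Coef (Icc 0 T) A D C C' G G' Q Q' β)
    (hD : Dense (D : Set X)) (hV : ∀ s, 0 ≤ s → ∀ x ∈ D,
      IsClassicalSolutionC1 (Bop A C Q) (fun _ => D) (fun _ => 0) s x (fun t => V t s x))
    {p : ℝ × ℝ} (hp : p ∈ {p : ℝ × ℝ | 0 ≤ p.2 ∧ p.2 ≤ p.1}) {l : Filter (ℝ × ℝ)}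
    (hl : l ≤ 𝓝[{p : ℝ × ℝ | 0 ≤ p.2 ∧ p.2 ≤ p.1}] p) {u : ℝ × ℝ → X} {y : X}
    (hu : Tendsto u l (𝓝 y)) : Tendsto (fun q => V q.1 q.2 (u q)) l (𝓝 (V p.1 p.2 y)) := by
  obtain ⟨t₀, s₀⟩ := p
  obtain ⟨hs₀, hst₀⟩ := hp
  simp only at hs₀ hst₀
  have hT : (0:ℝ) ≤ t₀ + 1 := by linarith
  obtain ⟨L, hL, hb⟩ := V_bound HK hD hV hT
  have hl1 : ∀ᶠ q in l, (0 ≤ q.2 ∧ q.2 ≤ q.1) ∧ q.1 ≤ t₀ + 1 := by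
    refine hl (Filter.inter_mem self_mem_nhdsWithin (mem_nhdsWithin_of_mem_nhds ?_))
    have : Tendsto (fun q : ℝ × ℝ => q.1) (𝓝 (t₀, s₀)) (𝓝 t₀) := continuous_fst.tendsto _
    exact this (Iic_mem_nhds (by linarith))
  have hln : l ≤ 𝓝 (t₀, s₀) := hl.trans nhdsWithin_le_nhds
  have lim1 : Tendsto (fun q : ℝ × ℝ => q.1) l (𝓝 t₀) := (continuous_fst.tendsto (t₀, s₀)).mono_left hln
  have lim2 : Tendsto (fun q : ℝ × ℝ => q.2) l (𝓝 s₀) := (continuous_snd.tendsto (t₀, s₀)).mono_left hln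
  refine tendsto_dense hD (c := L) ?_ (fun x hx => ?_) hu
  · filter_upwards [hl1] with q hq using hb _ _ hq.1.1 hq.1.2 hq.2
  obtain ⟨c, hc, hsm⟩ := V_small HK hV hT hx
  have hz := sol_of_C1 (hV s₀ hs₀ x hx)
  have hmax : Tendsto (fun q : ℝ × ℝ => max q.1 s₀) l (𝓝[Ici s₀] t₀) := by
    refine tendsto_nhdsWithin_iff.2 ⟨?_, Eventually.of_forall fun q => mem_Ici.2 (le_max_right _ _)⟩
    have := lim1.max (tendsto_const_nhds (x := s₀))
    rwa [max_eq_left hst₀] at this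
  have h1 : Tendsto (fun q : ℝ × ℝ => V (max q.1 s₀) s₀ x) l (𝓝 (V t₀ s₀ x)) :=
    (hz.1 t₀ hst₀).tendsto.comp hmax
  have h2 : Tendsto (fun q : ℝ × ℝ => V q.1 q.2 x - V (max q.1 s₀) s₀ x) l (𝓝 0) := by
    refine squeeze_zero_norm' (a := fun q : ℝ × ℝ => (L + 1) * √(c * |q.2 - s₀|)) ?_ ?_
    · filter_upwards [hl1] with q hq
      obtain ⟨⟨q1, q2⟩, q3⟩ := hq
      rcases le_total s₀ q.2 with h | h
      · rw [max_eq_left (h.trans q2), V_comp HK hD hV hs₀ h q2, ContinuousLinearMap.comp_apply,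
          ← map_sub]
        have := hsm s₀ q.2 hs₀ h (q2.trans q3)
        rw [abs_of_nonneg (by linarith)]
        refine ((V q.1 q.2).le_opNorm _).trans ?_
        rw [norm_sub_rev]
        have := hb _ _ q1 q2 q3
        gcongr
        linarith
      · rw [abs_sub_comm, abs_of_nonneg (by linarith)]
        rcases le_total s₀ q.1 with h' | h'
        · rw [max_eq_left h', V_comp HK hD hV q1 h h', ContinuousLinearMap.comp_apply, ← map_sub]
          have := hsm q.2 s₀ q1 h (h'.trans q3)
          refine ((V q.1 s₀).le_opNorm _).trans ?_
          have := hb _ _ hs₀ h' q3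
          gcongr
          linarith
        · have e : V s₀ s₀ x = x := hz.2.1
          rw [max_eq_right h', e]
          refine (hsm q.2 q.1 q1 q2 q3).trans ?_
          have a1 : √(c * (q.1 - q.2)) ≤ √(c * (s₀ - q.2)) := by gcongr
          have a2 := Real.sqrt_nonneg (c * (s₀ - q.2))
          nlinarith
    · have : Tendsto (fun q : ℝ × ℝ => (L + 1) * √(c * |q.2 - s₀|)) l
          (𝓝 ((L + 1) * √(c * |s₀ - s₀|))) :=
        ((((lim2.sub_const s₀).abs).const_mul c).sqrt).const_mul (L + 1)
      simpa using this
  have := h1.add h2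
  simpa using this

lemma V_cont_snd (HK : ∀ T, 0 ≤ T → ∃ β, Coef (Icc 0 T) A D C C' G G' Q Q' β)
    (hD : Dense (D : Set X)) (hV : ∀ s, 0 ≤ s → ∀ x ∈ D,
      IsClassicalSolutionC1 (Bop A C Q) (fun _ => D) (fun _ => 0) s x (fun t => V t s x))
    {r t : ℝ} (hr : r ∈ Icc 0 t) {l : Filter ℝ} (hl : l ≤ 𝓝[Icc 0 t] r) {u : ℝ → X} {y : X}
    (hu : Tendsto u l (𝓝 y)) : Tendsto (fun q => V t q (u q)) l (𝓝 (V t r y)) := by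
  have hpt : Tendsto (fun q : ℝ => (t, q)) l (𝓝[{p : ℝ × ℝ | 0 ≤ p.2 ∧ p.2 ≤ p.1}] (t, r)) := by
    refine tendsto_nhdsWithin_iff.2 ⟨?_, ?_⟩
    · exact ((by fun_prop : Continuous fun q : ℝ => (t, q)).tendsto r).mono_left
        (hl.trans nhdsWithin_le_nhds)
    · exact hl self_mem_nhdsWithin
  have hm : Tendsto (fun q : ℝ × ℝ => u q.2) (l.map fun q : ℝ => (t, q)) (𝓝 y) := by
    rw [tendsto_map'_iff]; exact hu
  have := V_cont HK hD hV (p := (t, r)) hr (l := l.map fun q : ℝ => (t, q)) hpt hm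
  rw [tendsto_map'_iff] at this
  exact this

lemma duhamel [CompleteSpace X] (HK : ∀ T, 0 ≤ T → ∃ β, Coef (Icc 0 T) A D C C' G G' Q Q' β)
    (hD : Dense (D : Set X)) (hV : ∀ s, 0 ≤ s → ∀ x ∈ D,
      IsClassicalSolutionC1 (Bop A C Q) (fun _ => D) (fun _ => 0) s x (fun t => V t s x))
    {s t : ℝ} (hs : 0 ≤ s) (hst : s ≤ t) {f z : ℝ → X} {zs : X} (hf : ContinuousOn f (Ici 0))
    (hz : IsClassicalSolutionC1 (Bop A C Q) (fun _ => D) f s zs z) :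
    IntervalIntegrable (fun r => V t r (f r)) volume s t ∧
    z t = V t s zs + ∫ r in s..t, V t r (f r) := by
  have hsub : Icc s t ⊆ Icc 0 t := Icc_subset_Icc_left hs
  have hzc := (sol_of_C1 hz).1
  have hIntg : IntervalIntegrable (fun r => V t r (f r)) volume s t := by
    refine ContinuousOn.intervalIntegrable ?_
    rw [uIcc_of_le hst]
    intro r hr
    exact V_cont_snd HK hD hV (hsub hr) (nhdsWithin_mono _ hsub)
      ((hf r (hsub hr).1).mono (hsub.trans Icc_subset_Ici_self)).tendsto
  refine ⟨hIntg, ?_⟩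
  have hcont : ContinuousOn (fun r => V t r (z r)) (Icc s t) := fun r hr =>
    V_cont_snd HK hD hV (hsub hr) (nhdsWithin_mono _ hsub)
      ((hzc r hr.1).mono Icc_subset_Ici_self).tendsto
  have hder : ∀ r ∈ Ioo s t, HasDerivWithinAt (fun r => V t r (z r)) (V t r (f r)) (Ioi r) r := by
    intro r hr
    have hr0 : 0 ≤ r := hs.trans hr.1.le
    have hv := hV r hr0 (z r) (hz.2.1 r hr.1.le)
    have g1 : HasDerivWithinAt (fun τ => z τ - V τ r (z r)) (f r) (Ioi r) r := by
      have a1 := ((sol_of_C1 hz).2.2.2.1 r hr.1).hasDerivWithinAt (s := Ioi r)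
      have a2 := (hv.2.2.1 r le_rfl).mono (Ioi_subset_Ici_self)
      convert a1.fun_sub a2 using 1
      have e : V r r (z r) = z r := hv.1
      beta_reduce
      rw [e]; abel
    rw [hasDerivWithinAt_iff_tendsto_slope' self_notMem_Ioi] at g1 ⊢
    have hle : 𝓝[Ioi r] r ≤ 𝓝[Icc 0 t] r := by
      rw [← nhdsWithin_Ioc_eq_nhdsGT hr.2]
      exact nhdsWithin_mono _ (fun τ hτ => ⟨hr0.trans hτ.1.le, hτ.2⟩)
    have h := V_cont_snd HK hD hV ⟨hr0, hr.2.le⟩ hle g1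
    refine h.congr' ?_
    filter_upwards [Ioc_mem_nhdsGT hr.2] with τ hτ
    have e : V r r (z r) = z r := hv.1
    rw [slope_def_module, slope_def_module, e, sub_self, sub_zero,
      ContinuousLinearMap.map_smul_of_tower, map_sub, V_comp HK hD hV hr0 hτ.1.le hτ.2,
      ContinuousLinearMap.comp_apply]
  have := intervalIntegral.integral_eq_sub_of_hasDeriv_right_of_le hst hcont hder hIntg
  rw [this, V_self hD hV (hs.trans hst), hz.1]
  simp

end Evol


section Coefs

open NBCS

lemma prod_coercive [CompleteSpace X] {M R : X →L[ℂ] X} {β γ : ℝ} (hβ : 0 < β)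
    (hM : ∀ x y, ⟪M x, y⟫ = ⟪x, M y⟫) (hR : ∀ x y, ⟪R x, y⟫ = ⟪x, R y⟫)
    (hMc : ∀ x, β * ‖x‖ ^ 2 ≤ (⟪M x, x⟫).re) (hRc : ∀ x, γ * ‖x‖ ^ 2 ≤ (⟪R x, x⟫).re)
    (hγ : 0 < γ) (hc : R.comp M = M.comp R) (x : X) : β * γ * ‖x‖ ^ 2 ≤ (⟪M (R x), x⟫).re := by
  have h1 : 0 ≤ M - (β : ℂ) • (1 : X →L[ℂ] X) := by
    rw [ContinuousLinearMap.nonneg_iff_isPositive]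
    refine ⟨fun x y => ?_, fun x => ?_⟩
    · show ⟪M x - (β : ℂ) • x, y⟫ = ⟪x, M y - (β : ℂ) • y⟫
      rw [inner_sub_left, inner_sub_right, hM, inner_smul_left, inner_smul_right, Complex.conj_ofReal]
    · show 0 ≤ (⟪M x - (β : ℂ) • x, x⟫).re
      have := hMc x
      rw [inner_sub_left, inner_smul_left, Complex.conj_ofReal, Complex.sub_re,
        Complex.re_ofReal_mul, re_inner_self]
      linarith
  have h2 : 0 ≤ R := by
    rw [ContinuousLinearMap.nonneg_iff_isPositive]
    refine ⟨fun x y => hR x y, fun x => ?_⟩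
    have := hRc x
    exact le_trans (by positivity) this
  have hcom : Commute (M - (β : ℂ) • (1 : X →L[ℂ] X)) R := by
    show _ * _ = _ * _
    rw [sub_mul, mul_sub, smul_one_mul, mul_smul_one]
    congr 1
    exact hc.symm
  have h3 := hcom.mul_nonneg h1 h2
  rw [ContinuousLinearMap.nonneg_iff_isPositive] at h3
  have h4 : 0 ≤ (⟪M (R x) - (β : ℂ) • R x, x⟫).re := h3.2 x
  rw [inner_sub_left, inner_smul_left, Complex.conj_ofReal, Complex.sub_re,
    Complex.re_ofReal_mul] at h4
  have := mul_le_mul_of_nonneg_left (hRc x) hβ.le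
  linarith

lemma exists_Rinv [CompleteSpace X] {R : ℝ → X →L[ℂ] X} (hRco : UniformlyCoercive R)
    (hRc : SCont (Ici 0) R) : ∃ Rinv : ℝ → X →L[ℂ] X, SCont (Ici 0) Rinv ∧
      (∀ t ∈ Ici (0:ℝ), (R t).comp (Rinv t) = 1) ∧ (∀ t ∈ Ici (0:ℝ), (Rinv t).comp (R t) = 1) := by
  obtain ⟨β, hβ, hco⟩ := hRco
  have hu : ∀ t, 0 ≤ t → ∃ S : X →L[ℂ] X, (R t).comp S = 1 ∧ S.comp (R t) = 1 := by
    intro t ht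
    have : IsUnit (R t) := by
      refine ContinuousLinearMap.isUnit_of_forall_le_norm_inner_map (R t) (c := ⟨β, hβ.le⟩) hβ ?_
      intro x
      have h1 := hco t ht x
      have h2 := Complex.re_le_norm (⟪R t x, x⟫)
      show ‖x‖ ^ 2 * β ≤ _
      linarith
    obtain ⟨u, hu⟩ := this
    refine ⟨↑u⁻¹, ?_, ?_⟩
    · rw [← hu]; exact u.mul_inv
    · rw [← hu]; exact u.inv_mul
  choose! S h1 h2 using hu
  have e1 : ∀ t, 0 ≤ t → ∀ x, R t (S t x) = x := fun t ht x => DFunLike.congr_fun (h1 t ht) x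
  have e2 : ∀ t, 0 ≤ t → ∀ x, S t (R t x) = x := fun t ht x => DFunLike.congr_fun (h2 t ht) x
  have hb : ∀ t, 0 ≤ t → ∀ x, ‖S t x‖ ≤ β⁻¹ * ‖x‖ := by
    intro t ht x
    have h3 := hco t ht (S t x)
    rw [e1 t ht] at h3
    have h4 := re_inner_le x (S t x)
    rw [← div_eq_inv_mul, le_div_iff₀ hβ]
    by_cases h0 : ‖S t x‖ = 0
    · rw [h0]; simp
    · have : 0 < ‖S t x‖ := lt_of_le_of_ne (norm_nonneg _) (Ne.symm h0)
      nlinarith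
  refine ⟨S, ⟨fun T => ⟨β⁻¹, by positivity, fun t ht _ =>
    ContinuousLinearMap.opNorm_le_bound _ (by positivity) (hb t ht)⟩, fun x t ht => ?_⟩, h1, h2⟩
  rw [ContinuousWithinAt, tendsto_iff_norm_sub_tendsto_zero]
  have h5 := (hRc.2 (S t x) t ht).tendsto
  rw [tendsto_iff_norm_sub_tendsto_zero] at h5
  refine squeeze_zero' (Eventually.of_forall fun _ => norm_nonneg _) ?_
    (by simpa using h5.const_mul β⁻¹)
  filter_upwards [self_mem_nhdsWithin] with τ hτ
  have : S τ x - S t x = - S τ (R τ (S t x) - R t (S t x)) := by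
    rw [map_sub, e2 τ hτ, e1 t ht]; abel
  rw [this, norm_neg]
  exact hb τ hτ _

lemma exists_coef [CompleteSpace X] {A : X →ₗ[ℂ] X} {domA : Submodule ℂ X}
    (hA : GeneratesContractionSemigroup A domA)
    {M P Minv P' R : ℝ → X →L[ℂ] X}
    (hMsa : SelfAdjointFamily M) (hMco : UniformlyCoercive M)
    (hM2 : ∀ x : X, ContDiffOn ℝ 2 (fun t => M t x) (Set.Ici (0:ℝ)))
    (hMinv : ∀ t, (0:ℝ) ≤ t → (M t).comp (Minv t) = 1 ∧ (Minv t).comp (M t) = 1)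
    (hMinvCont : ∀ x : X, ContinuousOn (fun t => Minv t x) (Set.Ici (0:ℝ)))
    (hP' : ∀ x : X, ∀ t ∈ Set.Ici (0:ℝ),
      HasDerivWithinAt (fun τ => P τ x) (P' t x) (Set.Ici (0:ℝ)) t)
    (hP'cont : ∀ x : X, ContinuousOn (fun t => P' t x) (Set.Ici (0:ℝ)))
    (hRsa : SelfAdjointFamily R) (hRco : UniformlyCoercive R)
    (hRC1 : ∀ x : X, ContDiffOn ℝ 1 (fun t => R t x) (Set.Ici (0:ℝ)))
    (hRM : ∀ t, (0:ℝ) ≤ t → (R t).comp (M t) = (M t).comp (R t)) :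
    ∃ M' C' G G' Q' : ℝ → X →L[ℂ] X, SDer (Ici 0) M M' ∧ SCont (Ici 0) M' ∧
      ∀ T, 0 ≤ T → ∃ β, Coef (Icc 0 T) A domA (fun t => (M t).comp (R t)) C' G G'
        (fun t => (M t).comp ((P t).comp (Minv t)) + (M' t).comp (Minv t)) Q' β := by
  have hM1 : ∀ x : X, ContDiffOn ℝ 1 (fun t => M t x) (Ici (0:ℝ)) :=
    fun x => (hM2 x).of_le (by norm_num)
  obtain ⟨M', hMd, hM'c, hM'eq⟩ := exists_SDer hM1
  have hM'1 : ∀ x : X, ContDiffOn ℝ 1 (fun t => M' t x) (Ici (0:ℝ)) := fun x =>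
    ((hM2 x).derivWithin (uniqueDiffOn_Ici 0) (m := 1) (by norm_num)).congr
      (fun t ht => hM'eq x t ht)
  obtain ⟨M'', hM'd, hM''c, -⟩ := exists_SDer hM'1
  obtain ⟨R', hRd, hR'c, -⟩ := exists_SDer hRC1
  have hMc : SCont (Ici 0) M := SCont.of_strong fun x => (hM1 x).continuousOn
  have hRc : SCont (Ici 0) R := SCont.of_strong fun x => (hRC1 x).continuousOn
  have hIc : SCont (Ici 0) Minv := SCont.of_strong hMinvCont
  have hPd : SDer (Ici 0) P P' := hP'
  have hP'c : SCont (Ici 0) P' := SCont.of_strong hP'cont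
  have hPc : SCont (Ici 0) P := SCont.of_strong hPd.continuousOn
  have hId := hMd.inv hIc (fun t ht => (hMinv t ht).1) (fun t ht => (hMinv t ht).2)
  have hI'c := (hIc.comp (hM'c.comp hIc)).neg
  obtain ⟨Rinv, hSc, hRS, hSR⟩ := exists_Rinv hRco hRc
  have hSd := hRd.inv hSc hRS hSR
  have hS'c := (hSc.comp (hR'c.comp hSc)).neg
  have eRS : ∀ t ∈ Ici (0:ℝ), ∀ x, R t (Rinv t x) = x :=
    fun t ht x => DFunLike.congr_fun (hRS t ht) x
  have eSR : ∀ t ∈ Ici (0:ℝ), ∀ x, Rinv t (R t x) = x :=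
    fun t ht x => DFunLike.congr_fun (hSR t ht) x
  have eMI : ∀ t ∈ Ici (0:ℝ), ∀ x, M t (Minv t x) = x :=
    fun t ht x => DFunLike.congr_fun (hMinv t ht).1 x
  have eIM : ∀ t ∈ Ici (0:ℝ), ∀ x, Minv t (M t x) = x :=
    fun t ht x => DFunLike.congr_fun (hMinv t ht).2 x
  have eRM : ∀ t ∈ Ici (0:ℝ), ∀ x, R t (M t x) = M t (R t x) :=
    fun t ht x => DFunLike.congr_fun (hRM t ht) x
  have hCsa : ∀ t ∈ Ici (0:ℝ), ∀ x y, ⟪M t (R t x), y⟫ = ⟪x, M t (R t y)⟫ := fun t ht x y => by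
    rw [hMsa t ht, hRsa t ht, eRM t ht]
  obtain ⟨β, hβ, hMb⟩ := hMco
  obtain ⟨γ, hγ, hRb⟩ := hRco
  have hCco : ∀ t ∈ Ici (0:ℝ), ∀ x, β * γ * ‖x‖ ^ 2 ≤ (⟪M t (R t x), x⟫).re := fun t ht x =>
    prod_coercive hβ (hMsa t ht) (hRsa t ht) (hMb t ht) (hRb t ht) hγ (hRM t ht) x
  have hCc := hMc.comp hRc
  have eCG : ∀ t ∈ Ici (0:ℝ), ∀ x, M t (R t (Rinv t (Minv t x))) = x := fun t ht x => by
    rw [eRS t ht, eMI t ht]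
  have eGC : ∀ t ∈ Ici (0:ℝ), ∀ x, Rinv t (Minv t (M t (R t x))) = x := fun t ht x => by
    rw [eIM t ht, eSR t ht]
  obtain ⟨C', hCd, hC'c⟩ : ∃ C' : ℝ → X →L[ℂ] X,
      SDer (Ici 0) (fun t => (M t).comp (R t)) C' ∧ SCont (Ici 0) C' :=
    ⟨_, hMd.comp hMc hRd, (hM'c.comp hRc).add (hMc.comp hR'c)⟩
  obtain ⟨G', hGd, hG'c⟩ : ∃ G' : ℝ → X →L[ℂ] X,
      SDer (Ici 0) (fun t => (Rinv t).comp (Minv t)) G' ∧ SCont (Ici 0) G' :=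
    ⟨_, hSd.comp hSc hId, (hS'c.comp hIc).add (hSc.comp hI'c)⟩
  obtain ⟨Q', hQd, hQ'c⟩ : ∃ Q' : ℝ → X →L[ℂ] X,
      SDer (Ici 0) (fun t => (M t).comp ((P t).comp (Minv t)) + (M' t).comp (Minv t)) Q' ∧
      SCont (Ici 0) Q' :=
    ⟨_, (hMd.comp hMc (hPd.comp hPc hId)).add (hM'd.comp hM'c hId),
      ((hM'c.comp (hPc.comp hIc)).add (hMc.comp ((hP'c.comp hIc).add (hPc.comp hI'c)))).add
        ((hM''c.comp hIc).add (hM'c.comp hI'c))⟩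
  refine ⟨M', C', fun t => (Rinv t).comp (Minv t), G', Q', hMd, hM'c, fun T hT => ?_⟩
  obtain ⟨c, hc, hcb⟩ := hCc.1 T
  have hsub : Icc 0 T ⊆ Ici (0:ℝ) := Icc_subset_Ici_self
  refine ⟨β * γ / (c + 1) ^ 2, ?_⟩
  exact
    { md := MaxDiss.of_generates hA
      hC := hCc.mono hsub
      hCd := hCd.mono hsub
      hC' := hC'c.mono hsub
      hG := (hSc.comp hIc).mono hsub
      hGd := hGd.mono hsub
      hG' := hG'c.mono hsub
      hQ := ((hMc.comp (hPc.comp hIc)).add (hM'c.comp hIc)).mono hsub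
      hQd := hQd.mono hsub
      hQ' := hQ'c.mono hsub
      hGC := fun t ht x => eGC t (hsub ht) x
      hCG := fun t ht x => eCG t (hsub ht) x
      hsa := fun t ht x y => by
        have h := hCsa t (hsub ht) (Rinv t (Minv t x)) (Rinv t (Minv t y))
        rw [eCG t (hsub ht), eCG t (hsub ht)] at h
        exact h.symm
      hβ := by positivity
      hco := fun t ht x => by
        set y := Rinv t (Minv t x) with hy
        have hxy : M t (R t y) = x := eCG t (hsub ht) x
        have h1 := hCco t (hsub ht) y
        rw [hCsa t (hsub ht), hxy] at h1
        have h2 : ‖x‖ ≤ (c + 1) * ‖y‖ := by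
          rw [← hxy]
          refine (((M t).comp (R t)).le_opNorm y).trans ?_
          have := hcb t (hsub ht) ht.2
          gcongr
          linarith
        have h3 : ‖x‖ ^ 2 ≤ (c + 1) ^ 2 * ‖y‖ ^ 2 := by
          rw [← mul_pow]; gcongr
        refine le_trans ?_ h1
        rw [div_mul_eq_mul_div, div_le_iff₀ (by positivity)]
        have : 0 ≤ β * γ := by positivity
        nlinarith }

/-- The operator `R(t)AM(t) + P(t)`. -/
abbrev Bx (A : X →ₗ[ℂ] X) (M P R : ℝ → X →L[ℂ] X) : ℝ → X →ₗ[ℂ] X :=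
  fun t => (R t : X →ₗ[ℂ] X) ∘ₗ (A ∘ₗ ((M t : X →ₗ[ℂ] X))) + ((P t : X →ₗ[ℂ] X))

lemma Bx_apply (A : X →ₗ[ℂ] X) (M P R : ℝ → X →L[ℂ] X) (t : ℝ) (x : X) :
    Bx A M P R t x = R t (A (M t x)) + P t x := rfl

section Transf

variable {A : X →ₗ[ℂ] X} {domA : Submodule ℂ X} {M P Minv R M' : ℝ → X →L[ℂ] X}

lemma to_z (hMc : SCont (Ici 0) M) (hM'c : SCont (Ici 0) M') (hMd : SDer (Ici 0) M M')
    (eIM : ∀ t ∈ Ici (0:ℝ), ∀ x, Minv t (M t x) = x)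
    {F x : ℝ → X} {s : ℝ} {xs : X} (hs : 0 ≤ s)
    (h : IsClassicalSolution (Bx A M P R) (fun t => domA.comap ((M t : X →ₗ[ℂ] X))) F s xs x) :
    IsClassicalSolution (Bop A (fun t => (M t).comp (R t))
      (fun t => (M t).comp ((P t).comp (Minv t)) + (M' t).comp (Minv t))) (fun _ => domA)
      (fun t => M t (F t)) s (M s xs) (fun t => M t (x t)) := by
  have hsub : Ici s ⊆ Ici (0:ℝ) := Ici_subset_Ici.2 hs
  have e : ∀ t ∈ Ici (0:ℝ), Bop A (fun t => (M t).comp (R t))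
      (fun t => (M t).comp ((P t).comp (Minv t)) + (M' t).comp (Minv t)) t (M t (x t)) + M t (F t)
      = M' t (x t) + M t (Bx A M P R t (x t) + F t) := by
    intro t ht
    have : Bop A (fun t => (M t).comp (R t))
      (fun t => (M t).comp ((P t).comp (Minv t)) + (M' t).comp (Minv t)) t (M t (x t)) =
      M t (R t (A (M t (x t)))) + (M t (P t (Minv t (M t (x t)))) + M' t (Minv t (M t (x t)))) := rfl
    rw [this, eIM t ht, Bx_apply, map_add, map_add]
    abel
  refine ⟨(hMc.mono hsub).apply h.1, by simp only [h.2.1], fun t ht => h.2.2.1 t ht,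
    fun t ht => ?_, ?_⟩
  · have ht0 : 0 < t := hs.trans_lt ht
    rw [e t ht0.le]
    exact (hMd.apply hMc ht0.le (h.2.2.2.1 t ht).hasDerivWithinAt).hasDerivAt (Ici_mem_nhds ht0)
  · have hsub' : Ioi s ⊆ Ici (0:ℝ) := Ioi_subset_Ici_self.trans hsub
    refine ContinuousOn.congr ?_ (fun t ht => e t (hsub' ht))
    exact ((hM'c.mono hsub').apply (h.1.mono Ioi_subset_Ici_self)).add
      ((hMc.mono hsub').apply h.2.2.2.2)

lemma from_z (hIc : SCont (Ici 0) Minv) (hM'c : SCont (Ici 0) M')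
    (hId : SDer (Ici 0) Minv (fun t => -((Minv t).comp ((M' t).comp (Minv t)))))
    (eIM : ∀ t ∈ Ici (0:ℝ), ∀ x, Minv t (M t x) = x)
    (eMI : ∀ t ∈ Ici (0:ℝ), ∀ x, M t (Minv t x) = x)
    {F z : ℝ → X} {s : ℝ} {xs : X} (hs : 0 ≤ s)
    (h : IsClassicalSolution (Bop A (fun t => (M t).comp (R t))
      (fun t => (M t).comp ((P t).comp (Minv t)) + (M' t).comp (Minv t))) (fun _ => domA)
      (fun t => M t (F t)) s (M s xs) z) :
    IsClassicalSolution (Bx A M P R) (fun t => domA.comap ((M t : X →ₗ[ℂ] X))) F s xs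
      (fun t => Minv t (z t)) := by
  have hsub : Ici s ⊆ Ici (0:ℝ) := Ici_subset_Ici.2 hs
  have e : ∀ t ∈ Ici (0:ℝ), Bx A M P R t (Minv t (z t)) + F t =
      (-((Minv t).comp ((M' t).comp (Minv t)))) (z t) +
      Minv t (Bop A (fun t => (M t).comp (R t))
      (fun t => (M t).comp ((P t).comp (Minv t)) + (M' t).comp (Minv t)) t (z t) + M t (F t)) := by
    intro t ht
    have : Bop A (fun t => (M t).comp (R t))
      (fun t => (M t).comp ((P t).comp (Minv t)) + (M' t).comp (Minv t)) t (z t) =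
      M t (R t (A (z t))) + (M t (P t (Minv t (z t))) + M' t (Minv t (z t))) := rfl
    have e2 : (-((Minv t).comp ((M' t).comp (Minv t)))) (z t) = - Minv t (M' t (Minv t (z t))) := rfl
    rw [this, e2, Bx_apply, eMI t ht, map_add, map_add, map_add, eIM t ht, eIM t ht, eIM t ht]
    abel
  refine ⟨(hIc.mono hsub).apply h.1, by simp only [h.2.1, eIM s hs], fun t ht => ?_,
    fun t ht => ?_, ?_⟩
  · show M t (Minv t (z t)) ∈ domA
    rw [eMI t (hsub ht)]
    exact h.2.2.1 t ht
  · have ht0 : 0 < t := hs.trans_lt ht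
    rw [e t ht0.le]
    exact (hId.apply hIc ht0.le (h.2.2.2.1 t ht).hasDerivWithinAt).hasDerivAt (Ici_mem_nhds ht0)
  · have hsub' : Ioi s ⊆ Ici (0:ℝ) := Ioi_subset_Ici_self.trans hsub
    refine ContinuousOn.congr ?_ (fun t ht => e t (hsub' ht))
    exact ((((hIc.comp (hM'c.comp hIc)).neg).mono hsub').apply (h.1.mono Ioi_subset_Ici_self)).add
      ((hIc.mono hsub').apply h.2.2.2.2)

end Transf

end Coefs

end RAM

/-- Let `(A, D(A))` generate a contraction `C₀`-semigroup on a Hilbert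
space `X`, `M`, `P` as in Statement 4 and `R` self-adjoint, uniformly coercive, strongly
`C¹` and commuting with `M`.  Then `{R(t)AM(t) + P(t)}` generates a unique evolution family
`W` with regularity spaces `Y_t = M(t)⁻¹D(A)`, and for `F ∈ C¹`, `s > 0`,
`x_s ∈ M(s)⁻¹D(A)` the problem `ẋ = R(t)AM(t)x + P(t)x + F(t)`, `x(s) = x_s` has the unique
classical solution `x(t) = W(t,s)x_s + ∫_s^t W(t,r)F(r) dr`. -/
theorem RAM_perturbed_generates
    {X : Type*} [NormedAddCommGroup X] [InnerProductSpace ℂ X] [CompleteSpace X]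
    (A : X →ₗ[ℂ] X) (domA : Submodule ℂ X)
    (hA : NBCS.GeneratesContractionSemigroup A domA)
    (M P Minv P' R : ℝ → X →L[ℂ] X)
    (hMsa : NBCS.SelfAdjointFamily M) (hMco : NBCS.UniformlyCoercive M)
    (hPsa : NBCS.SelfAdjointFamily P) (hPco : NBCS.UniformlyCoercive P)
    (hM2 : ∀ x : X, ContDiffOn ℝ 2 (fun t => M t x) (Set.Ici (0:ℝ)))
    (hMinv : ∀ t, (0:ℝ) ≤ t → (M t).comp (Minv t) = 1 ∧ (Minv t).comp (M t) = 1)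
    (hMinvCont : ∀ x : X, ContinuousOn (fun t => Minv t x) (Set.Ici (0:ℝ)))
    (hP' : ∀ x : X, ∀ t ∈ Set.Ici (0:ℝ),
      HasDerivWithinAt (fun τ => P τ x) (P' t x) (Set.Ici (0:ℝ)) t)
    (hP'cont : ∀ x : X, ContinuousOn (fun t => P' t x) (Set.Ici (0:ℝ)))
    (hRsa : NBCS.SelfAdjointFamily R) (hRco : NBCS.UniformlyCoercive R)
    (hRC1 : ∀ x : X, ContDiffOn ℝ 1 (fun t => R t x) (Set.Ici (0:ℝ)))
    (hRM : ∀ t, (0:ℝ) ≤ t → (R t).comp (M t) = (M t).comp (R t)) :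
    ∃ W : ℝ → ℝ → X →L[ℂ] X,
      NBCS.Generates
        (fun t => (R t : X →ₗ[ℂ] X) ∘ₗ (A ∘ₗ ((M t : X →ₗ[ℂ] X))) + ((P t : X →ₗ[ℂ] X)))
        (fun t => domA.comap ((M t : X →ₗ[ℂ] X))) W
        (fun t => domA.comap ((M t : X →ₗ[ℂ] X))) ∧
      (∀ W' : ℝ → ℝ → X →L[ℂ] X,
        NBCS.Generates
          (fun t => (R t : X →ₗ[ℂ] X) ∘ₗ (A ∘ₗ ((M t : X →ₗ[ℂ] X))) + ((P t : X →ₗ[ℂ] X)))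
          (fun t => domA.comap ((M t : X →ₗ[ℂ] X))) W'
          (fun t => domA.comap ((M t : X →ₗ[ℂ] X))) →
        ∀ s t : ℝ, 0 ≤ s → s ≤ t → W' t s = W t s) ∧
      ∀ F : ℝ → X, ContDiffOn ℝ 1 F (Set.Ici (0:ℝ)) →
        ∀ s : ℝ, 0 < s → ∀ xs ∈ domA.comap ((M s : X →ₗ[ℂ] X)),
          NBCS.IsClassicalSolution
            (fun t => (R t : X →ₗ[ℂ] X) ∘ₗ (A ∘ₗ ((M t : X →ₗ[ℂ] X))) + ((P t : X →ₗ[ℂ] X)))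
            (fun t => domA.comap ((M t : X →ₗ[ℂ] X))) F s xs
            (fun t => W t s xs + ∫ r in s..t, W t r (F r)) ∧
          ∀ x : ℝ → X,
            NBCS.IsClassicalSolution
              (fun t => (R t : X →ₗ[ℂ] X) ∘ₗ (A ∘ₗ ((M t : X →ₗ[ℂ] X))) +
                ((P t : X →ₗ[ℂ] X)))
              (fun t => domA.comap ((M t : X →ₗ[ℂ] X))) F s xs x →
            ∀ t, s ≤ t → x t = W t s xs + ∫ r in s..t, W t r (F r) := by
  obtain ⟨M', C', G, G', Q', hMd, hM'c, HK⟩ := RAM.exists_coef hA hMsa hMco hM2 hMinv hMinvCont hP'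
    hP'cont hRsa hRco hRC1 hRM
  have hMc : RAM.SCont (Ici 0) M := RAM.SCont.of_strong hMd.continuousOn
  have hIc : RAM.SCont (Ici 0) Minv := RAM.SCont.of_strong hMinvCont
  have hId := hMd.inv hIc (fun t ht => (hMinv t ht).1) (fun t ht => (hMinv t ht).2)
  have eMI : ∀ t ∈ Ici (0:ℝ), ∀ x, M t (Minv t x) = x :=
    fun t ht x => DFunLike.congr_fun (hMinv t ht).1 x
  have eIM : ∀ t ∈ Ici (0:ℝ), ∀ x, Minv t (M t x) = x :=
    fun t ht x => DFunLike.congr_fun (hMinv t ht).2 x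
  have hD : Dense (domA : Set X) := (RAM.MaxDiss.of_generates hA).dense
  obtain ⟨V, hV⟩ := RAM.exists_V HK
  have hYd : ∀ t, 0 ≤ t → Dense ((domA.comap ((M t : X →ₗ[ℂ] X)) : Submodule ℂ X) : Set X) := by
    intro t ht
    have ho : IsOpenMap (M t) := (M t).isOpenMap fun y => ⟨Minv t y, eMI t ht y⟩
    exact hD.preimage ho
  have hsol : ∀ s, 0 ≤ s → ∀ xs ∈ domA.comap ((M s : X →ₗ[ℂ] X)),
      NBCS.IsClassicalSolution (RAM.Bx A M P R)
        (fun t => domA.comap ((M t : X →ₗ[ℂ] X))) (fun _ => 0) s xs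
        (fun t => ((Minv t).comp ((V t s).comp (M s))) xs) := by
    intro s hs xs hxs
    have h := RAM.sol_of_C1 (hV s hs (M s xs) hxs)
    refine RAM.from_z (F := fun _ => 0) hIc hM'c hId eIM eMI hs ?_
    simp only [map_zero]
    exact h
  have huniq : ∀ s, 0 ≤ s → ∀ xs ∈ domA.comap ((M s : X →ₗ[ℂ] X)), ∀ (F x y : ℝ → X),
      NBCS.IsClassicalSolution (RAM.Bx A M P R)
        (fun t => domA.comap ((M t : X →ₗ[ℂ] X))) F s xs x →
      NBCS.IsClassicalSolution (RAM.Bx A M P R)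
        (fun t => domA.comap ((M t : X →ₗ[ℂ] X))) F s xs y → ∀ t, s ≤ t → x t = y t := by
    intro s hs xs hxs F x y hx hy t ht
    have h := RAM.sol_unique HK hs (RAM.to_z hMc hM'c hMd eIM hs hx)
      (RAM.to_z hMc hM'c hMd eIM hs hy) t ht
    have h' := congrArg (Minv t) h
    rwa [eIM t (hs.trans ht), eIM t (hs.trans ht)] at h'
  refine ⟨fun t s => (Minv t).comp ((V t s).comp (M s)), ⟨⟨?_, ?_, ?_⟩, hYd, fun t _ => le_rfl, ?_,
    hsol, ?_⟩, ?_, ?_⟩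
  · intro t ht
    ext x
    show Minv t (V t t (M t x)) = x
    rw [RAM.V_self hD hV ht]
    exact eIM t ht x
  · intro s r t hs hsr hrt
    ext x
    show Minv t (V t s (M s x)) = Minv t (V t r (M r (Minv r (V r s (M s x)))))
    rw [eMI r (hs.trans hsr), RAM.V_comp HK hD hV hs hsr hrt]
    rfl
  · intro x p hp
    have hp1 : 0 ≤ p.1 := hp.1.trans hp.2
    set S : Set (ℝ × ℝ) := {p : ℝ × ℝ | 0 ≤ p.2 ∧ p.2 ≤ p.1} with hS
    have l1 : Tendsto (fun q : ℝ × ℝ => q.1) (nhdsWithin p S) (nhdsWithin p.1 (Ici 0)) :=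
      tendsto_nhdsWithin_iff.2 ⟨(continuous_fst.tendsto p).mono_left nhdsWithin_le_nhds,
        by filter_upwards [self_mem_nhdsWithin] with q hq using hq.1.trans hq.2⟩
    have l2 : Tendsto (fun q : ℝ × ℝ => q.2) (nhdsWithin p S) (nhdsWithin p.2 (Ici 0)) :=
      tendsto_nhdsWithin_iff.2 ⟨(continuous_snd.tendsto p).mono_left nhdsWithin_le_nhds,
        by filter_upwards [self_mem_nhdsWithin] with q hq using hq.1⟩
    have h1 : Tendsto (fun q : ℝ × ℝ => M q.2 x) (nhdsWithin p S) (nhds (M p.2 x)) :=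
      (hMc.2 x p.2 hp.1).tendsto.comp l2
    have h2 := RAM.V_cont HK hD hV hp le_rfl h1
    obtain ⟨c, hc, hcb⟩ := hIc.1 (p.1 + 1)
    refine RAM.tendsto_dense (D := ⊤) (by simp) (K := fun q : ℝ × ℝ => Minv q.1) (k := Minv p.1)
      (c := c) ?_ (fun y _ => (hIc.2 y p.1 hp1).tendsto.comp l1) h2
    have l3 := l1.mono_right nhdsWithin_le_nhds
    filter_upwards [self_mem_nhdsWithin, l3 (Iic_mem_nhds (lt_add_one p.1))] with q hq hq'
    exact hcb _ (hq.1.trans hq.2) hq'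
  · intro s t hs hst x hx
    exact (hsol s hs x hx).2.2.1 t hst
  · intro s hs xs hxs x hx t ht
    exact huniq s hs xs hxs _ x _ hx (hsol s hs xs hxs) t ht
  · intro W' hW' s t hs hst
    refine RAM.ext_dense (hYd s hs) fun x hx => ?_
    exact (hW'.2.2.2.2.2 s hs x hx _ (hsol s hs x hx) t hst).symm
  · intro F hF s hs xs hxs
    have hFd : ∀ t ∈ Ici (0:ℝ), HasDerivWithinAt F (derivWithin F (Ici 0) t) (Ici 0) t :=
      fun t ht => ((hF.differentiableOn (by norm_num)) t ht).hasDerivWithinAt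
    have hF'c : ContinuousOn (derivWithin F (Ici 0)) (Ici 0) :=
      hF.continuousOn_derivWithin (uniqueDiffOn_Ici 0) le_rfl
    obtain ⟨z, hz⟩ := RAM.sol_exists HK hs.le (f := fun t => M t (F t))
      (fun t ht => hMd.apply hMc ht (hFd t ht))
      ((hM'c.apply hF.continuousOn).add (hMc.apply hF'c)) hxs
    have hx := RAM.from_z hIc hM'c hId eIM eMI hs.le (RAM.sol_of_C1 hz)
    have hform : ∀ t, s ≤ t → (((Minv t).comp ((V t s).comp (M s))) xs +
        ∫ r in s..t, ((Minv t).comp ((V t r).comp (M r))) (F r)) = Minv t (z t) := by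
      intro t ht
      obtain ⟨hi, he⟩ := RAM.duhamel HK hD hV hs.le ht (hMc.apply hF.continuousOn) hz
      rw [he, map_add]
      congr 1
      exact (Minv t).intervalIntegral_comp_comm hi
    have hx' := RAM.sol_congr hx hform
    exact ⟨hx', fun x hxx t ht => huniq s hs.le xs hxs _ x _ hxx hx' t ht⟩
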